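/- arXiv:2409.16648 — 8 statements merged into one kernel-verified Lean document; each statement's English description precedes it below -/
import Mathlib

section
/- For every integer d ≥ 0 there exist nonnegative rational numbers a_0, a_1, …, a_d such that for all natural numbers n, T_d(n) = Σ_{i=0}^{d} a_i · n^i · (1+n)^{d-i}. (That is, the Ehrhart polynomial of the dual Stasheff polytope St_d^* is magic positive.) -/
/-- `stT d n` counts the lattice points of the `n`-th dilate of the dual Stasheff
polytope `St_d^*`: the number of `x ∈ ℤ^d` with `-n ≤ x i ≤ n` for all `i` and
`x j + ⋯ + x k ≤ n` for all `j < k`. -/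
noncomputable def stT (d n : ℕ) : ℕ :=
  Set.ncard {x : Fin d → ℤ |
    (∀ i, -(n : ℤ) ≤ x i ∧ x i ≤ (n : ℤ)) ∧
    ∀ j k : Fin d, j < k → ∑ i ∈ Finset.Icc j k, x i ≤ (n : ℤ)}

/-- Points with an incoming maximal suffix sum `s`. -/
def stS (n : ℕ) (d : ℕ) (s : ℤ) : Set (Fin d → ℤ) :=
  {x | (∀ i, -(n : ℤ) ≤ x i) ∧
    (∀ j k : Fin d, j ≤ k → ∑ i ∈ Finset.Icc j k, x i ≤ (n : ℤ)) ∧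
    ∀ k : Fin d, s + ∑ i ∈ Finset.Iic k, x i ≤ (n : ℤ)}

lemma st_sum_Icc_succ {d : ℕ} (y : ℤ) (t : Fin d → ℤ) (j k : Fin d) :
    ∑ i ∈ Finset.Icc j.succ k.succ, (Fin.cons y t : Fin (d + 1) → ℤ) i =
      ∑ i ∈ Finset.Icc j k, t i := by
  rw [← Fin.map_succEmb_Icc, Finset.sum_map]
  simp

lemma st_sum_Iic_succ {d : ℕ} (y : ℤ) (t : Fin d → ℤ) (k : Fin d) :
    ∑ i ∈ Finset.Iic k.succ, (Fin.cons y t : Fin (d + 1) → ℤ) i =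
      y + ∑ i ∈ Finset.Iic k, t i := by
  have h : Finset.Iic k.succ = insert 0 ((Finset.Iic k).map (Fin.succEmb d)) := by
    ext i
    refine Fin.cases ?_ (fun i => ?_) i
    · simp
    · simp [Fin.succ_ne_zero]
  rw [h, Finset.sum_insert (by simp [Fin.succ_ne_zero]), Finset.sum_map]
  simp

lemma st_Icc_zero {d : ℕ} (k : Fin (d + 1)) : Finset.Icc 0 k = Finset.Iic k := by
  ext i; simp

lemma st_Iic_zero {d : ℕ} : Finset.Iic (0 : Fin (d + 1)) = {0} := by
  ext i; simp

lemma stS_cons {n d : ℕ} {s : ℤ} (hs : 0 ≤ s) (y : ℤ) (t : Fin d → ℤ) :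
    (Fin.cons y t : Fin (d + 1) → ℤ) ∈ stS n (d + 1) s ↔
      (-(n : ℤ) ≤ y ∧ s + y ≤ n) ∧ t ∈ stS n d (max 0 (s + y)) := by
  constructor
  · rintro ⟨h1, h2, h3⟩
    refine ⟨⟨by simpa using h1 0, by simpa [st_Iic_zero] using h3 0⟩, fun i => by
      simpa using h1 i.succ, fun j k hjk => ?_, fun k => ?_⟩
    · have := h2 j.succ k.succ (by simpa using hjk)
      rwa [st_sum_Icc_succ] at this
    · have a := h3 k.succ
      rw [st_sum_Iic_succ] at a
      have b : ∑ i ∈ Finset.Iic k, t i ≤ (n : ℤ) := by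
        cases d with
        | zero => exact k.elim0
        | succ d =>
          have := h2 (Fin.succ 0) k.succ (Fin.succ_le_succ_iff.2 (Fin.zero_le k))
          rwa [st_sum_Icc_succ, st_Icc_zero] at this
      rcases max_choice 0 (s + y) with h | h <;> rw [h] <;> linarith
  · rintro ⟨⟨hy1, hy2⟩, h1, h2, h3⟩
    have key : ∀ k : Fin (d + 1),
        s + ∑ i ∈ Finset.Iic k, (Fin.cons y t : Fin (d + 1) → ℤ) i ≤ (n : ℤ) := by
      intro k
      refine Fin.cases ?_ (fun k => ?_) k
      · simpa [st_Iic_zero] using hy2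
      · rw [st_sum_Iic_succ]
        have := h3 k
        have := le_max_right 0 (s + y)
        linarith
    refine ⟨fun i => ?_, fun j k => ?_, key⟩
    · refine Fin.cases ?_ (fun i => ?_) i
      · simpa using hy1
      · simpa using h1 i
    · refine Fin.cases ?_ (fun j => ?_) j
      · intro _
        rw [st_Icc_zero]
        linarith [key k]
      · refine Fin.cases ?_ (fun k => ?_) k
        · intro h
          simp at h
        · intro h
          rw [st_sum_Icc_succ]
          exact h2 j k (by simpa using h)

/-- Splitting off the first coordinate. -/
def stEquiv (n d : ℕ) (s : ℤ) (hs : 0 ≤ s) :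
    stS n (d + 1) s ≃ Σ z : Finset.Icc (s - n) (n : ℤ), stS n d (max 0 (z : ℤ)) where
  toFun x := ⟨⟨s + x.1 0, by
      have := x.2
      rw [← Fin.cons_self_tail x.1, stS_cons hs] at this
      rw [Finset.mem_Icc]
      constructor <;> linarith [this.1.1, this.1.2]⟩, ⟨Fin.tail x.1, by
      have := x.2
      rw [← Fin.cons_self_tail x.1, stS_cons hs] at this
      exact this.2⟩⟩
  invFun p := ⟨Fin.cons (p.1.1 - s) p.2.1, by
      rw [stS_cons hs]
      have := Finset.mem_Icc.1 p.1.2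
      refine ⟨⟨by linarith [this.1], by linarith [this.2]⟩, ?_⟩
      have h := p.2.2
      rwa [add_sub_cancel]⟩
  left_inv x := by
    apply Subtype.ext
    simp
  right_inv p := by
    obtain ⟨⟨z, hz⟩, ⟨t, ht⟩⟩ := p
    have e : s + (z - s) = z := by ring
    refine Sigma.ext (Subtype.ext (by simp)) ?_
    simp only [Fin.tail_cons]
    have : ∀ w : ℤ, w = z → ∀ h : t ∈ stS n d (max 0 w),
        HEq (⟨t, h⟩ : stS n d (max 0 w)) (⟨t, ht⟩ : stS n d (max 0 z)) := by
      rintro w rfl h; rfl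
    exact this _ (by simp) _

instance stS_finite (n d : ℕ) (s : ℤ) : Finite (stS n d s) := by
  refine Set.Finite.subset (Set.finite_Icc (fun _ : Fin d => -(n : ℤ)) (fun _ => (n : ℤ))) ?_
  rintro x ⟨h1, h2, -⟩
  exact ⟨fun i => h1 i, fun i => by simpa using h2 i i le_rfl⟩

/-- The pair `(T_d, T_{d-1})`. -/
def stQ (n : ℕ) : ℕ → ℚ × ℚ
  | 0 => (1, 0)
  | d + 1 => ((2 * n + 1) * (stQ n d).1 - n * (n + 1) / 2 * (stQ n d).2, (stQ n d).1)

lemma st_sum_aux (L : ℤ) (hL : L ≤ 0) (p q : ℚ) (m : ℕ) :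
    ∑ z ∈ Finset.Icc L (m : ℤ), (p - ((max 0 z : ℤ) : ℚ) * q) =
      (m + 1 - L) * p - m * (m + 1) / 2 * q := by
  induction m with
  | zero =>
    have : ∀ z ∈ Finset.Icc L ((0 : ℕ) : ℤ), (p - ((max 0 z : ℤ) : ℚ) * q) = p := by
      intro z hz
      rw [max_eq_left (by simpa using (Finset.mem_Icc.1 hz).2)]
      simp
    rw [Finset.sum_congr rfl this, Finset.sum_const, Int.card_Icc, nsmul_eq_mul]
    have h : (((((0 : ℕ) : ℤ) + 1 - L).toNat : ℤ) : ℚ) = (1 - L : ℚ) := by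
      rw [Int.toNat_of_nonneg (by simp; omega)]
      push_cast; ring
    rw [Int.cast_natCast] at h
    rw [h]
    simp
  | succ m ih =>
    have : Finset.Icc L ((m + 1 : ℕ) : ℤ) = insert ((m + 1 : ℕ) : ℤ) (Finset.Icc L (m : ℤ)) := by
      ext z; simp only [Finset.mem_Icc, Finset.mem_insert]; omega
    rw [this, Finset.sum_insert (by simp), ih, max_eq_right (by positivity)]
    push_cast
    ring

lemma stS_card (n d : ℕ) : ∀ s : ℤ, 0 ≤ s → s ≤ n →
    (Nat.card (stS n d s) : ℚ) = (stQ n d).1 - s * (stQ n d).2 := by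
  induction d with
  | zero =>
    intro s _ _
    have : stS n 0 s = Set.univ := by
      ext x; simp [stS]
    rw [this]
    simp [stQ]
  | succ d ih =>
    intro s hs hsn
    rw [Nat.card_congr (stEquiv n d s hs), Nat.card_sigma]
    push_cast
    have h : ∀ z : Finset.Icc (s - n) (n : ℤ), (Nat.card (stS n d (max 0 (z : ℤ))) : ℚ) =
        (stQ n d).1 - ((max 0 (z : ℤ) : ℤ) : ℚ) * (stQ n d).2 := by
      intro z
      have := Finset.mem_Icc.1 z.2
      exact ih _ (le_max_left _ _) (max_le (by positivity) this.2)
    rw [Finset.sum_congr rfl (fun z _ => h z)]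
    rw [Finset.sum_coe_sort (Finset.Icc (s - n) (n : ℤ))
      (fun z => (stQ n d).1 - ((max 0 (z : ℤ) : ℤ) : ℚ) * (stQ n d).2)]
    rw [st_sum_aux _ (by linarith)]
    simp only [stQ]
    push_cast
    ring

lemma stT_eq (d n : ℕ) : (stT d n : ℚ) = (stQ n d).1 := by
  have h : {x : Fin d → ℤ |
    (∀ i, -(n : ℤ) ≤ x i ∧ x i ≤ (n : ℤ)) ∧
    ∀ j k : Fin d, j < k → ∑ i ∈ Finset.Icc j k, x i ≤ (n : ℤ)} = stS n d 0 := by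
    ext x
    constructor
    · rintro ⟨h1, h2⟩
      have h3 : ∀ j k : Fin d, j ≤ k → ∑ i ∈ Finset.Icc j k, x i ≤ (n : ℤ) := by
        intro j k hjk
        rcases hjk.eq_or_lt with rfl | h
        · simpa using (h1 j).2
        · exact h2 j k h
      refine ⟨fun i => (h1 i).1, h3, fun k => ?_⟩
      cases d with
      | zero => exact k.elim0
      | succ d =>
        rw [zero_add, ← st_Icc_zero]
        exact h3 0 k (by simp)
    · rintro ⟨h1, h2, -⟩
      exact ⟨fun i => ⟨h1 i, by simpa using h2 i i le_rfl⟩, fun j k h => h2 j k h.le⟩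
  have := stS_card n d 0 le_rfl (by positivity)
  rw [stT, h, ← Nat.card_coe_set_eq, this]
  simp

/-- Magic positivity in degree `d`. -/
def stMP (d : ℕ) (f : ℕ → ℚ) : Prop :=
  ∃ a : ℕ → ℚ, (∀ i, 0 ≤ a i) ∧
    ∀ n : ℕ, f n = ∑ i ∈ Finset.range (d + 1), a i * (n : ℚ) ^ i * (1 + (n : ℚ)) ^ (d - i)

lemma stMP.add {d : ℕ} {f g : ℕ → ℚ} (hf : stMP d f) (hg : stMP d g) :
    stMP d (fun n => f n + g n) := by
  obtain ⟨a, ha, hf⟩ := hf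
  obtain ⟨b, hb, hg⟩ := hg
  refine ⟨fun i => a i + b i, fun i => add_nonneg (ha i) (hb i), fun n => ?_⟩
  simp only [hf, hg, ← Finset.sum_add_distrib, add_mul]

lemma stMP.smul {d : ℕ} {f : ℕ → ℚ} (hf : stMP d f) (c : ℚ) (hc : 0 ≤ c) :
    stMP d (fun n => c * f n) := by
  obtain ⟨a, ha, hf⟩ := hf
  refine ⟨fun i => c * a i, fun i => mul_nonneg hc (ha i), fun n => ?_⟩
  simp only [hf, Finset.mul_sum, mul_assoc]

lemma stMP.mulA {d : ℕ} {f : ℕ → ℚ} (hf : stMP d f) :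
    stMP (d + 1) (fun n => n * f n) := by
  obtain ⟨a, ha, hf⟩ := hf
  refine ⟨fun i => if i = 0 then 0 else a (i - 1), fun i => ?_, fun n => ?_⟩
  · dsimp only
    split_ifs
    exacts [le_rfl, ha _]
  · rw [Finset.sum_range_succ']
    simp only [hf, Finset.mul_sum]
    simp
    refine Finset.sum_congr rfl fun i _ => ?_
    ring

lemma stMP.mulB {d : ℕ} {f : ℕ → ℚ} (hf : stMP d f) :
    stMP (d + 1) (fun n => (1 + n) * f n) := by
  obtain ⟨a, ha, hf⟩ := hf
  refine ⟨fun i => if i = d + 1 then 0 else a i, fun i => ?_, fun n => ?_⟩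
  · dsimp only
    split_ifs
    exacts [le_rfl, ha _]
  · rw [Finset.sum_range_succ]
    simp only [hf, Finset.mul_sum]
    simp only [if_true, zero_mul, add_zero]
    refine Finset.sum_congr rfl fun i hi => ?_
    have := Finset.mem_range.1 hi
    rw [if_neg (by omega), Nat.sub_add_comm (by omega), pow_succ]
    ring

lemma stMP_main (d : ℕ) : stMP d (fun n => (stQ n d).1) ∧
    stMP (d + 1) (fun n => (stQ n (d + 1)).1) ∧
    stMP (d + 1) (fun n => (stQ n (d + 1)).1 - n * (stQ n d).1) := by
  induction d with
  | zero =>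
    have h : stMP 0 (fun n => (stQ n 0).1) := ⟨fun _ => 1, by simp, by simp [stQ]⟩
    refine ⟨h, ?_, ?_⟩
    · convert h.mulA.add h.mulB using 2
      simp [stQ]; ring
    · convert h.mulB using 2
      simp [stQ]; ring
  | succ d ih =>
    obtain ⟨h0, h1, h2⟩ := ih
    have h3 : stMP (d + 1 + 1) (fun n => (stQ n (d + 1 + 1)).1 - n * (stQ n (d + 1)).1) := by
      convert h2.mulB.add (h0.mulB.mulA.smul (1 / 2) (by norm_num)) using 2
      simp only [stQ]; ring
    refine ⟨h1, ?_, h3⟩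
    convert h3.add h1.mulA using 2
    ring

/-- The Ehrhart polynomial of the dual Stasheff polytope is magic positive. -/
theorem stasheff_dual_magic_positive (d : ℕ) :
    ∃ a : ℕ → ℚ, (∀ i, 0 ≤ a i) ∧
      ∀ n : ℕ, (stT d n : ℚ) =
        ∑ i ∈ Finset.range (d + 1), a i * (n : ℚ) ^ i * (1 + (n : ℚ)) ^ (d - i) := by
  obtain ⟨a, ha, h⟩ := (stMP_main d).1
  exact ⟨a, ha, fun n => by rw [stT_eq]; exact h n⟩
end

section
/- Let d ≥ 2 and n ∈ ℕ, and let x = (x_1,…,x_d) ∈ ℤ^d satisfy: -n ≤ x_i ≤ n for all 1 ≤ i ≤ d, and x_j + ⋯ + x_k ≤ n for all 1 ≤ j < k ≤ d−1. Let M = max(0, max_{1 ≤ i ≤ d−2} (x_i + ⋯ + x_{d−2})), where M = 0 when d = 2. Then: (i) x_{d−1} ≤ n − M; and (ii) x fails some remaining constraint of the dilated dual Stasheff polytope (i.e. x_j + ⋯ + x_d > n for some 1 ≤ j ≤ d−1) if and only if x_{d−1} + x_d > n − M. -/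
/-- `M = max(0, max_{1 ≤ i ≤ d-2} (x_i + ⋯ + x_{d-2}))` (with `M = 0` when `d = 2`),
written with 0-indexed coordinates: the maximum of `0` and the suffix sums of the
first `d - 2` coordinates. -/
def sufM {d : ℕ} (x : Fin d → ℤ) : ℤ :=
  (Finset.range (d - 2)).fold max 0 fun i =>
    ∑ k ∈ Finset.univ.filter (fun k : Fin d => i ≤ k.val ∧ k.val + 2 < d), x k

/-- The set of indices at least `j` splits off the last two coordinates. -/
theorem sum_Icc_split {d : ℕ} (hd : 2 ≤ d) (x : Fin d → ℤ) (j : Fin d) (hj : j.val + 1 < d) :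
    ∑ i ∈ Finset.Icc j ⟨d - 2, by omega⟩, x i =
      x ⟨d - 2, by omega⟩ +
        ∑ k ∈ Finset.univ.filter (fun k : Fin d => j.val ≤ k.val ∧ k.val + 2 < d), x k := by
  rw [← Finset.sum_insert (by simp; omega)]
  congr 1
  ext k
  simp only [Finset.mem_Icc, Finset.mem_insert, Finset.mem_filter, Finset.mem_univ, true_and,
    Fin.le_def, Fin.ext_iff]
  omega

theorem sum_Ici_split {d : ℕ} (hd : 2 ≤ d) (x : Fin d → ℤ) (j : Fin d) (hj : j.val + 1 < d) :
    ∑ i ∈ Finset.Ici j, x i =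
      x ⟨d - 1, by omega⟩ + (x ⟨d - 2, by omega⟩ +
        ∑ k ∈ Finset.univ.filter (fun k : Fin d => j.val ≤ k.val ∧ k.val + 2 < d), x k) := by
  rw [← sum_Icc_split hd x j hj, ← Finset.sum_insert (by simp [Fin.le_def]; omega)]
  congr 1
  ext k
  simp only [Finset.mem_Icc, Finset.mem_insert, Finset.mem_Ici, Fin.le_def, Fin.ext_iff]
  omega

theorem suffix_last {d : ℕ} (x : Fin d → ℤ) (j : ℕ) (hj : d ≤ j + 2) :
    ∑ k ∈ Finset.univ.filter (fun k : Fin d => j ≤ k.val ∧ k.val + 2 < d), x k = 0 := by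
  rw [Finset.filter_false_of_mem, Finset.sum_empty]
  intro k _
  omega

/-- Lattice points of `n·(St_{d-1}^* × [-1,1])`: (i) satisfy `x_{d-1} ≤ n - M`, and
(ii) violate some remaining constraint of `n·St_d^*` (i.e. `x_j + ⋯ + x_d > n` for
some `1 ≤ j ≤ d-1`) iff `x_{d-1} + x_d > n - M`. (Coordinates are 0-indexed, so
the math `x_{d-1}, x_d` are `x ⟨d-2⟩, x ⟨d-1⟩`.) -/
theorem stasheff_dual_strip_description (d n : ℕ) (hd : 2 ≤ d) (x : Fin d → ℤ)
    (hbox : ∀ i, -(n : ℤ) ≤ x i ∧ x i ≤ (n : ℤ))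
    (hsum : ∀ j k : Fin d, j < k → k.val + 2 ≤ d → ∑ i ∈ Finset.Icc j k, x i ≤ (n : ℤ)) :
    x ⟨d - 2, by omega⟩ ≤ (n : ℤ) - sufM x ∧
    ((∃ j : Fin d, j.val + 1 < d ∧ (n : ℤ) < ∑ i ∈ Finset.Ici j, x i) ↔
      (n : ℤ) - sufM x < x ⟨d - 2, by omega⟩ + x ⟨d - 1, by omega⟩) := by
  constructor
  · have key : sufM x ≤ (n : ℤ) - x ⟨d - 2, by omega⟩ := by
      unfold sufM
      rw [Finset.fold_max_le]
      refine ⟨by linarith [(hbox ⟨d - 2, by omega⟩).2], ?_⟩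
      intro i hi
      rw [Finset.mem_range] at hi
      have h1 := hsum ⟨i, by omega⟩ ⟨d - 2, by omega⟩ (by simp only [Fin.lt_def]; omega)
        (by simp only; omega)
      rw [sum_Icc_split hd x ⟨i, by omega⟩ (by simp only; omega)] at h1
      simp only at h1
      linarith
    linarith
  · constructor
    · rintro ⟨j, hj, hlt⟩
      rw [sum_Ici_split hd x j hj] at hlt
      have key : ∑ k ∈ Finset.univ.filter (fun k : Fin d => j.val ≤ k.val ∧ k.val + 2 < d), x k
          ≤ sufM x := by
        unfold sufM
        rw [Finset.le_fold_max]
        by_cases h : j.val < d - 2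
        · exact Or.inr ⟨j.val, Finset.mem_range.2 h, le_rfl⟩
        · exact Or.inl (suffix_last x j.val (by omega)).le
      linarith
    · intro hlt
      have key : (n : ℤ) - x ⟨d - 2, by omega⟩ - x ⟨d - 1, by omega⟩ < sufM x := by linarith
      unfold sufM at key
      rw [Finset.lt_fold_max] at key
      rcases key with h | ⟨i, hi, h⟩
      · refine ⟨⟨d - 2, by omega⟩, by simp only; omega, ?_⟩
        rw [sum_Ici_split hd x ⟨d - 2, by omega⟩ (by simp only; omega),
          suffix_last x _ (by simp only; omega)]
        linarith
      · rw [Finset.mem_range] at hi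
        refine ⟨⟨i, by omega⟩, by simp only; omega, ?_⟩
        rw [sum_Ici_split hd x ⟨i, by omega⟩ (by simp only; omega)]
        simp only
        linarith
end

section
/- Let d ≥ 1 be an integer and let p, q, r ∈ ℚ[X] satisfy r = (2X+1)·q − (1/2)·X·(X+1)·p. Suppose there exist nonnegative rationals b_0,…,b_{d−1} with q − (1/2)·X·p = Σ_{i=0}^{d−1} b_i X^i (1+X)^{d−1−i}, and nonnegative rationals c_0,…,c_{d−1} with q = Σ_{i=0}^{d−1} c_i X^i (1+X)^{d−1−i}. Then there exist nonnegative rationals a_0,…,a_d with r = Σ_{i=0}^{d} a_i X^i (1+X)^{d−i}, and nonnegative rationals a'_0,…,a'_d with r − (1/2)·X·q = Σ_{i=0}^{d} a'_i X^i (1+X)^{d−i}. (The key identity is r − (1/2)Xq = (1/2)Xq + (X+1)(q − (1/2)Xp).) -/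
open Polynomial

/-- `t X Q + (1 + X) B` is magic positive of degree `n + 1` if `Q`, `B` are of degree `n`. -/
theorem magic_step_aux (n : ℕ) (t : ℚ) (ht : 0 ≤ t) (b c : ℕ → ℚ)
    (hb : ∀ i, 0 ≤ b i) (hc : ∀ i, 0 ≤ c i) :
    ∃ a : ℕ → ℚ, (∀ i, 0 ≤ a i) ∧
      C t * X * (∑ i ∈ Finset.range (n + 1), C (c i) * X ^ i * (1 + X) ^ (n - i)) +
        (1 + X) * (∑ i ∈ Finset.range (n + 1), C (b i) * X ^ i * (1 + X) ^ (n - i)) =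
      ∑ i ∈ Finset.range (n + 1 + 1), C (a i) * X ^ i * (1 + X) ^ (n + 1 - i) := by
  refine ⟨fun i => (if i = 0 then 0 else t * c (i - 1)) + (if i < n + 1 then b i else 0),
    fun i => ?_, ?_⟩
  · refine add_nonneg ?_ ?_
    · split_ifs
      · exact le_rfl
      · exact mul_nonneg ht (hc _)
    · split_ifs
      · exact hb i
      · exact le_rfl
  · simp only [C_add, add_mul, Finset.sum_add_distrib]
    congr 1
    · rw [Finset.sum_range_succ' _ (n + 1), Finset.mul_sum]
      simp only [if_true, C_0, zero_mul, add_zero]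
      refine Finset.sum_congr rfl fun i _ => ?_
      have h : n + 1 - (i + 1) = n - i := by omega
      rw [h, if_neg (Nat.succ_ne_zero i), Nat.add_sub_cancel, C_mul]
      ring
    · rw [← add_mul, Finset.sum_range_succ _ (n + 1), Finset.mul_sum]
      simp only [lt_irrefl, if_false, C_0, zero_mul, add_zero]
      refine Finset.sum_congr rfl fun i hi => ?_
      have hi' := Finset.mem_range.mp hi
      have h : n + 1 - i = (n - i) + 1 := by omega
      rw [h, if_pos hi']
      ring

/-- The induction step for magic positivity of the dual Stasheff Ehrhart polynomials:
if `r = (2X+1)q - (1/2)X(X+1)p`, and both `q - (1/2)Xp` and `q` are magic positive of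
degree `d-1`, then both `r` and `r - (1/2)Xq` are magic positive of degree `d`. -/
theorem magic_positive_induction_step (d : ℕ) (hd : 1 ≤ d) (p q r : Polynomial ℚ)
    (hr : r = (2 * X + 1) * q - C (1/2 : ℚ) * X * (X + 1) * p)
    (hb : ∃ b : ℕ → ℚ, (∀ i, 0 ≤ b i) ∧
      q - C (1/2 : ℚ) * X * p =
        ∑ i ∈ Finset.range d, C (b i) * X ^ i * (1 + X) ^ (d - 1 - i))
    (hc : ∃ c : ℕ → ℚ, (∀ i, 0 ≤ c i) ∧
      q = ∑ i ∈ Finset.range d, C (c i) * X ^ i * (1 + X) ^ (d - 1 - i)) :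
    (∃ a : ℕ → ℚ, (∀ i, 0 ≤ a i) ∧
      r = ∑ i ∈ Finset.range (d + 1), C (a i) * X ^ i * (1 + X) ^ (d - i)) ∧
    (∃ a' : ℕ → ℚ, (∀ i, 0 ≤ a' i) ∧
      r - C (1/2 : ℚ) * X * q =
        ∑ i ∈ Finset.range (d + 1), C (a' i) * X ^ i * (1 + X) ^ (d - i)) := by
  obtain ⟨n, rfl⟩ : ∃ n, d = n + 1 := ⟨d - 1, by omega⟩
  obtain ⟨b, hb0, hb⟩ := hb
  obtain ⟨c, hc0, hc⟩ := hc
  rw [Nat.add_sub_cancel] at hb hc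
  have hC : (C (1 / 2 : ℚ) : Polynomial ℚ) + C (1 / 2 : ℚ) = 1 := by
    rw [← C_add]; norm_num
  constructor
  · obtain ⟨a, ha0, ha⟩ := magic_step_aux n 1 zero_le_one b c hb0 hc0
    refine ⟨a, ha0, ?_⟩
    rw [← ha, ← hb, ← hc, hr, C_1]
    ring
  · obtain ⟨a, ha0, ha⟩ := magic_step_aux n (1 / 2) (by norm_num) b c hb0 hc0
    refine ⟨a, ha0, ?_⟩
    rw [← ha, ← hb, ← hc, hr]
    linear_combination (-X * q) * hC
end

section
/- For every integer d ≥ 1 and every natural number n, Cyc_d(n) = Σ_{i=0}^{⌊d/2⌋} (−1)^i · binomial(d+1, i) · binomial((d+1−2i)·n + d − i, d). -/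
/-- `cycCount d n` counts the lattice points of the `n`-th dilate of the dual of the
symmetric edge polytope of the `(d+1)`-cycle: the number of `x ∈ ℤ^d` with
`|x i| ≤ n` for all `i` and `|x 1 + ⋯ + x d| ≤ n`. -/
noncomputable def cycCount (d n : ℕ) : ℕ :=
  Set.ncard {x : Fin d → ℤ | (∀ i, |x i| ≤ (n : ℤ)) ∧ |∑ i, x i| ≤ (n : ℤ)}

open PowerSeries in
/-- The box count as a coefficient of a power of a geometric sum. -/
lemma cyc_coeff_box (k M s : ℕ) :
    PowerSeries.coeff s ((∑ j ∈ Finset.range M, (X : PowerSeries ℤ) ^ j) ^ k) =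
      (((Fintype.piFinset (fun _ : Fin k => Finset.range M)).filter
        (fun p => ∑ i, p i = s)).card : ℤ) := by
  have h := Finset.prod_univ_sum (fun _ : Fin k => Finset.range M)
    (fun _ j => (X : PowerSeries ℤ) ^ j)
  rw [Finset.prod_const, Finset.card_univ, Fintype.card_fin] at h
  rw [h, map_sum, Finset.card_filter, Nat.cast_sum]
  refine Finset.sum_congr rfl fun p _ => ?_
  rw [Finset.prod_pow_eq_pow_sum, coeff_X_pow]
  by_cases hp : ∑ i, p i = s
  · simp [hp]
  · simp [hp, Ne.symm hp]

open PowerSeries in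
/-- The same coefficient by inclusion-exclusion. -/
lemma cyc_coeff_formula (d M s : ℕ) :
    PowerSeries.coeff s ((∑ j ∈ Finset.range M, (X : PowerSeries ℤ) ^ j) ^ (d + 1)) =
      ∑ i ∈ Finset.range (d + 2), (-1 : ℤ) ^ i * ((d + 1).choose i : ℤ) *
        (if i * M ≤ s then ((d + (s - i * M)).choose d : ℤ) else 0) := by
  have h1 : (∑ j ∈ Finset.range M, (X : PowerSeries ℤ) ^ j) ^ (d + 1) * (1 - X) ^ (d + 1)
      = (1 - X ^ M) ^ (d + 1) := by
    rw [← mul_pow, geom_sum_mul_neg]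
  have h2 : (1 - X : PowerSeries ℤ) ^ (d + 1) *
      (PowerSeries.mk fun n => ((d + n).choose d : ℤ)) = 1 := by
    rw [mul_comm]
    exact mk_add_choose_mul_one_sub_pow_eq_one ℤ d
  have h3 : (∑ j ∈ Finset.range M, (X : PowerSeries ℤ) ^ j) ^ (d + 1) =
      (1 - X ^ M) ^ (d + 1) * (PowerSeries.mk fun n => ((d + n).choose d : ℤ)) := by
    rw [← h1, mul_assoc, h2, mul_one]
  have h4 : (1 - X ^ M : PowerSeries ℤ) ^ (d + 1) =
      ∑ i ∈ Finset.range (d + 2),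
        PowerSeries.C ((-1 : ℤ) ^ i * ((d + 1).choose i : ℤ)) * X ^ (i * M) := by
    rw [sub_eq_neg_add, add_pow]
    refine Finset.sum_congr rfl fun i _ => ?_
    rw [neg_pow, ← pow_mul, mul_comm M i]
    simp only [map_mul, map_pow, map_neg, map_one, map_natCast, one_pow]
    ring
  rw [h3, h4, Finset.sum_mul, map_sum]
  refine Finset.sum_congr rfl fun i _ => ?_
  rw [mul_assoc, coeff_C_mul, coeff_X_pow_mul']
  simp

lemma cyc_count_eq (d n : ℕ) :
    cycCount d n = ((Fintype.piFinset (fun _ : Fin (d + 1) => Finset.range (2 * n + 1))).filter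
        (fun p => ∑ i, p i = (d + 1) * n)).card := by
  rw [← Set.ncard_coe_finset, cycCount]
  symm
  refine Set.ncard_congr (fun p _ => fun i : Fin d => (p i.succ : ℤ) - n) ?_ ?_ ?_
  · intro p hp
    simp only [Finset.coe_filter, Fintype.mem_piFinset, Finset.mem_range, Set.mem_ofPred_eq] at hp
    obtain ⟨hb, hs⟩ := hp
    have hs' : ((p 0 : ℕ) : ℤ) + ∑ i : Fin d, (p i.succ : ℤ) = (d + 1) * n := by
      rw [Fin.sum_univ_succ] at hs
      exact_mod_cast hs
    refine ⟨fun i => ?_, ?_⟩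
    · have := hb i.succ
      show |(p i.succ : ℤ) - n| ≤ n
      rw [abs_le]
      constructor <;> omega
    · have := hb 0
      simp only [Finset.sum_sub_distrib, Finset.sum_const, Finset.card_univ, Fintype.card_fin,
        nsmul_eq_mul]
      have e : ∑ i : Fin d, (p i.succ : ℤ) - d * n = n - p 0 := by linarith
      rw [e, abs_le]
      constructor <;> omega
  · intro p q hp hq hpq
    simp only [Finset.coe_filter, Fintype.mem_piFinset, Finset.mem_range, Set.mem_ofPred_eq]
      at hp hq
    have h1 : ∀ i : Fin d, p i.succ = q i.succ := fun i => by
      have : (p i.succ : ℤ) - n = (q i.succ : ℤ) - n := congrFun hpq i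
      omega
    have hs := hp.2.trans hq.2.symm
    rw [Fin.sum_univ_succ, Fin.sum_univ_succ, Finset.sum_congr rfl (fun i _ => h1 i)] at hs
    funext i
    refine Fin.cases ?_ h1 i
    omega
  · rintro x ⟨hx, hs⟩
    rw [abs_le] at hs
    have hx' : ∀ i, -(n : ℤ) ≤ x i ∧ x i ≤ n := fun i => abs_le.mp (hx i)
    refine ⟨Fin.cons ((n : ℤ) - ∑ i, x i).toNat (fun i => ((n : ℤ) + x i).toNat), ?_, ?_⟩
    · simp only [Finset.coe_filter, Fintype.mem_piFinset, Finset.mem_range, Set.mem_ofPred_eq]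
      constructor
      · intro i
        refine Fin.cases ?_ (fun j => ?_) i
        · rw [Fin.cons_zero]; omega
        · rw [Fin.cons_succ]; have := hx' j; omega
      · rw [Fin.sum_univ_succ]
        simp only [Fin.cons_zero, Fin.cons_succ]
        zify
        rw [Int.toNat_of_nonneg (by omega),
          Finset.sum_congr rfl (fun i _ => Int.toNat_of_nonneg (by have := hx' i; omega))]
        simp only [Finset.sum_add_distrib, Finset.sum_const, Finset.card_univ, Fintype.card_fin,
          nsmul_eq_mul]
        ring
    · funext i
      simp only [Fin.cons_succ]
      have := hx' i
      omega

/-- The Ehrhart polynomial of the dual symmetric edge polytope of a cycle: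
`Cyc_d(n) = Σ_{i=0}^{⌊d/2⌋} (-1)^i C(d+1, i) C((d+1-2i)n + d - i, d)`. -/
theorem cycle_dual_ehrhart (d : ℕ) (hd : 1 ≤ d) (n : ℕ) :
    (cycCount d n : ℤ) =
      ∑ i ∈ Finset.range (d / 2 + 1),
        (-1 : ℤ) ^ i * (Nat.choose (d + 1) i : ℤ) *
          (Nat.choose ((d + 1 - 2 * i) * n + (d - i)) d : ℤ) := by
  rw [cyc_count_eq, ← cyc_coeff_box, cyc_coeff_formula]
  symm
  rw [← Finset.sum_subset (s₁ := Finset.range (d / 2 + 1)) (s₂ := Finset.range (d + 2))]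
  · refine Finset.sum_congr rfl fun i hi => ?_
    rw [Finset.mem_range] at hi
    congr 1
    obtain ⟨c, hc⟩ : ∃ c, d + 1 = 2 * i + c := ⟨d + 1 - 2 * i, by omega⟩
    have e1 : d + 1 - 2 * i = c := by omega
    have e2 : (d + 1) * n = 2 * (i * n) + c * n := by rw [hc]; ring
    have e3 : i * (2 * n + 1) = 2 * (i * n) + i := by ring
    rw [e1, e2, e3]
    split_ifs with h
    · congr 2
      omega
    · rw [Nat.choose_eq_zero_of_lt (by omega)]
      rfl
  · intro i hi
    simp only [Finset.mem_range] at *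
    omega
  · intro i _ hi
    rw [Finset.mem_range] at hi
    have h1 : (d + 1) * n ≤ (2 * i) * n := Nat.mul_le_mul_right _ (by omega)
    have e3 : i * (2 * n + 1) = 2 * i * n + i := by ring
    rw [if_neg (by rw [e3]; omega), mul_zero]
end

section
/- Let d ≥ 2 and let a_0, a_1, …, a_d be rational numbers such that Cyc_d(n) = Σ_{j=0}^{d} a_j · n^j · (1+n)^{d−j} for all natural numbers n. Then a_0 > 0, a_1 > 0, a_2 > 0, a_{d−2} > 0, a_{d−1} > 0, and a_d > 0. -/
open Finset

def zsum (n : ℕ) : ℚ := ∑ i ∈ range n, 1 / ((i : ℚ) + 1) ^ 2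

lemma zsum_succ (n : ℕ) : zsum (n + 1) = zsum n + 1 / ((n : ℚ) + 1) ^ 2 := by
  simp [zsum, sum_range_succ]

def e2s (n : ℕ) : ℚ := (harmonic n ^ 2 - zsum n) / 2

lemma e2s_succ (n : ℕ) : e2s (n + 1) = e2s n + harmonic n / ((n : ℚ) + 1) := by
  have : (n : ℚ) + 1 ≠ 0 := by positivity
  simp only [e2s, zsum_succ, harmonic_succ]
  push_cast
  field_simp
  ring

lemma sumV (d q : ℕ) (h : q ≤ d) :
    ∑ k ∈ range q, (1 / ((k : ℚ) + 1) - 1 / ((d : ℚ) - k)) =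
      harmonic q - harmonic d + harmonic (d - q) := by
  induction q with
  | zero => simp
  | succ q ih =>
    rw [sum_range_succ, ih (by omega)]
    obtain ⟨r, rfl⟩ := Nat.exists_eq_add_of_le h
    have h1 : q + 1 + r - q = r + 1 := by omega
    have h2 : q + 1 + r - (q + 1) = r := by omega
    rw [h1, h2, harmonic_succ q, harmonic_succ r]
    push_cast
    have : (q : ℚ) + 1 + r - q = r + 1 := by ring
    rw [this]
    ring

lemma sumU (d q : ℕ) (h : q ≤ d) :
    ∑ k ∈ range q, (harmonic (d - (k + 1)) - harmonic k) =
      d * harmonic d - ((d : ℚ) - q) * harmonic (d - q) - q * harmonic q := by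
  induction q with
  | zero => simp
  | succ q ih =>
    rw [sum_range_succ, ih (by omega)]
    obtain ⟨r, rfl⟩ := Nat.exists_eq_add_of_le h
    have h1 : q + 1 + r - q = r + 1 := by omega
    have h2 : q + 1 + r - (q + 1) = r := by omega
    rw [h1, h2, harmonic_succ q, harmonic_succ r]
    have : (q : ℚ) + 1 ≠ 0 := by positivity
    have : (r : ℚ) + 1 ≠ 0 := by positivity
    push_cast
    field_simp
    ring

lemma sumR (d q : ℕ) (h : q ≤ d) :
    ∑ k ∈ range q, (1 / ((k : ℚ) + 1) + 1 / ((d : ℚ) - k)) *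
        (harmonic (d - (k + 1)) - harmonic k) =
      harmonic q * harmonic (d - q) + e2s d - e2s (d - q) - e2s q := by
  induction q with
  | zero => simp [e2s, zsum]
  | succ q ih =>
    rw [sum_range_succ, ih (by omega)]
    obtain ⟨r, rfl⟩ := Nat.exists_eq_add_of_le h
    have h1 : q + 1 + r - q = r + 1 := by omega
    have h2 : q + 1 + r - (q + 1) = r := by omega
    rw [h1, h2, harmonic_succ q, harmonic_succ r, e2s_succ q, e2s_succ r]
    push_cast
    have : (q : ℚ) + 1 + r - q = r + 1 := by ring
    rw [this]
    have : (q : ℚ) + 1 ≠ 0 := by positivity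
    have : (r : ℚ) + 1 ≠ 0 := by positivity
    field_simp
    ring

/-- closed form of the linear coefficient -/
lemma closed1 (d : ℕ) :
    harmonic d - ∑ k ∈ range (d / 2), (1 / ((k : ℚ) + 1) - 1 / ((d : ℚ) - k)) =
      2 * (harmonic (2 * ((d + 1) / 2)) - harmonic ((d + 1) / 2)) := by
  rw [sumV d _ (by omega)]
  rcases Nat.even_or_odd' d with ⟨p, rfl | rfl⟩
  · rw [show 2 * p / 2 = p by omega, show (2 * p + 1) / 2 = p by omega,
      show 2 * p - p = p by omega]
    ring
  · rw [show (2 * p + 1) / 2 = p by omega, show (2 * p + 1 + 1) / 2 = p + 1 by omega,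
      show 2 * p + 1 - p = p + 1 by omega, show 2 * (p + 1) = 2 * p + 1 + 1 by ring,
      harmonic_succ (2 * p + 1), harmonic_succ p]
    have : (p : ℚ) + 1 ≠ 0 := by positivity
    push_cast
    rw [show (2 * (p : ℚ) + 1 + 1) = 2 * (p + 1) by ring]
    field_simp
    ring

lemma closed2 (d : ℕ) :
    ((d : ℚ) + 1) ^ 2 * e2s d - ((d : ℚ) + 1) ^ 2 * (∑ k ∈ range (d / 2),
      (1 / ((k : ℚ) + 1) + 1 / ((d : ℚ) - k)) * (harmonic (d - (k + 1)) - harmonic k))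
      + 4 * (d + 1) * (∑ k ∈ range (d / 2), (harmonic (d - (k + 1)) - harmonic k)) =
      4 * (d + 1) * d * (harmonic (2 * ((d + 1) / 2)) - harmonic ((d + 1) / 2))
       - ((d : ℚ) + 1) ^ 2 * zsum ((d + 1) / 2) := by
  rw [sumR d _ (by omega), sumU d _ (by omega)]
  rcases Nat.even_or_odd' d with ⟨p, rfl | rfl⟩
  · rw [show 2 * p / 2 = p by omega, show (2 * p + 1) / 2 = p by omega,
      show 2 * p - p = p by omega]
    simp only [e2s]
    push_cast
    ring
  · rw [show (2 * p + 1) / 2 = p by omega, show (2 * p + 1 + 1) / 2 = p + 1 by omega,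
      show 2 * p + 1 - p = p + 1 by omega, show 2 * (p + 1) = 2 * p + 1 + 1 by ring,
      e2s_succ p, zsum_succ p, harmonic_succ (2 * p + 1), harmonic_succ p]
    have : (p : ℚ) + 1 ≠ 0 := by positivity
    simp only [e2s]
    push_cast
    rw [show (2 * (p : ℚ) + 1 + 1) = 2 * (p + 1) by ring]
    field_simp
    ring

lemma L_succ (p : ℕ) : harmonic (2 * (p + 1)) - harmonic (p + 1) =
    harmonic (2 * p) - harmonic p + 1 / ((2 * (p : ℚ) + 1) * (2 * (p : ℚ) + 2)) := by
  rw [show 2 * (p + 1) = 2 * p + 1 + 1 by ring, harmonic_succ, harmonic_succ, harmonic_succ]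
  push_cast
  rw [show (2 * (p : ℚ) + 1 + 1) = 2 * (p + 1) by ring, show (2 * (p : ℚ) + 2) = 2 * (p + 1) by ring]
  field_simp
  ring

lemma L_ge (p : ℕ) : 1 / 2 ≤ harmonic (2 * (p + 1)) - harmonic (p + 1) := by
  induction p with
  | zero => norm_num [harmonic, sum_range_succ]
  | succ p ih =>
    rw [L_succ]
    have : 0 < 1 / ((2 * ((p + 1 : ℕ) : ℚ) + 1) * (2 * ((p + 1 : ℕ) : ℚ) + 2)) := by positivity
    linarith

lemma W_ge (p : ℕ) : -1 / 2 + 2 / (2 * (p : ℚ) + 5) ≤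
    2 * (harmonic (2 * (p + 2)) - harmonic (p + 2)) - zsum (p + 2) := by
  induction p with
  | zero => norm_num [harmonic, zsum, sum_range_succ]
  | succ p ih =>
    rw [show p + 1 + 2 = p + 2 + 1 by ring, L_succ, zsum_succ]
    push_cast
    have h0 : 0 < 1 / ((2 * ((p : ℚ) + 2) + 1) * (2 * ((p : ℚ) + 2) + 2)) := by positivity
    have : 2 / (2 * ((p : ℚ) + 1) + 5) + 1 / ((p : ℚ) + 2 + 1) ^ 2 ≤ 2 / (2 * (p : ℚ) + 5) := by
      rw [div_add_div _ _ (by positivity) (by positivity), div_le_div_iff₀ (by positivity) (by positivity)]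
      have : (0 : ℚ) ≤ p := by positivity
      nlinarith
    linarith

lemma final1 (d : ℕ) (hd : 2 ≤ d) :
    0 < 2 * ((d : ℚ) + 1) * (harmonic (2 * ((d + 1) / 2)) - harmonic ((d + 1) / 2)) - d := by
  obtain ⟨p, hp⟩ : ∃ p, (d + 1) / 2 = p + 1 := ⟨(d + 1) / 2 - 1, by omega⟩
  rw [hp]
  have := L_ge p
  have h : (0 : ℚ) < d + 1 := by positivity
  nlinarith

lemma final2 (d : ℕ) (hd : 2 ≤ d) :
    0 < ((d : ℚ) + 1) ^ 2 * (2 * (harmonic (2 * ((d + 1) / 2)) - harmonic ((d + 1) / 2))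
      - zsum ((d + 1) / 2)) + d * (d - 1) / 2 := by
  rcases Nat.eq_or_lt_of_le hd with rfl | hd
  · norm_num [harmonic, zsum, sum_range_succ]
  obtain ⟨p, hp⟩ : ∃ p, (d + 1) / 2 = p + 2 := ⟨(d + 1) / 2 - 2, by omega⟩
  rw [hp]
  have := W_ge p
  have h2 : 2 / ((d : ℚ) + 2) ≤ 2 / (2 * (p : ℚ) + 5) := by
    apply div_le_div_of_nonneg_left (by norm_num) (by positivity)
    have : 2 * p + 5 ≤ d + 2 := by omega
    exact_mod_cast this
  have h3 : ((d : ℚ) + 1) ^ 2 * (-1 / 2 + 2 / ((d : ℚ) + 2)) + d * (d - 1) / 2 > 0 := by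
    have : ((d : ℚ) + 1) ^ 2 * (-1 / 2 + 2 / ((d : ℚ) + 2)) + d * (d - 1) / 2 =
      (d ^ 2 + d + 2) / (2 * (d + 2)) := by
      field_simp
      ring
    rw [this]
    have : (3 : ℚ) ≤ d := by exact_mod_cast hd
    apply div_pos <;> nlinarith
  have h4 : ((d : ℚ) + 1) ^ 2 * (-1 / 2 + 2 / ((d : ℚ) + 2)) ≤ ((d : ℚ) + 1) ^ 2 *
    (2 * (harmonic (2 * (p + 2)) - harmonic (p + 2)) - zsum (p + 2)) := by
    apply mul_le_mul_of_nonneg_left _ (by positivity)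
    linarith
  linarith

lemma cyc_card (d n : ℕ) : cycCount d n =
    #{p ∈ Fintype.piFinset (fun _ : Fin (d + 1) => range (2 * n + 1)) | ∑ i, p i = (d + 1) * n} := by
  rw [cycCount, ← Set.ncard_coe_finset]
  symm
  refine Set.ncard_congr (fun p _ => fun i : Fin d => (p i.succ : ℤ) - n) ?_ ?_ ?_
  · intro p hp
    simp only [coe_filter, Fintype.mem_piFinset, mem_range, Set.mem_ofPred_eq] at hp ⊢
    obtain ⟨h1, h2⟩ := hp
    refine ⟨fun i => ?_, ?_⟩
    · have := h1 i.succ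
      rw [abs_le]; omega
    · rw [Fin.sum_univ_succ] at h2
      have h0 := h1 0
      have h3 : (p 0 : ℤ) + ∑ i : Fin d, (p i.succ : ℤ) = (d + 1) * n := by exact_mod_cast h2
      rw [sum_sub_distrib]
      simp only [sum_const, card_univ, Fintype.card_fin, nsmul_eq_mul]
      rw [abs_le]
      constructor <;> linarith [(by exact_mod_cast h0 : (p 0 : ℤ) < 2 * n + 1)]
  · intro p q hp hq h
    simp only [coe_filter, Fintype.mem_piFinset, mem_range, Set.mem_ofPred_eq] at hp hq
    have hs : ∀ i : Fin d, p i.succ = q i.succ := fun i => by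
      have := congrFun h i
      omega
    have h0 : p 0 = q 0 := by
      have h1 := hp.2
      have h2 := hq.2
      rw [Fin.sum_univ_succ] at h1 h2
      simp only [hs] at h1
      omega
    funext i
    refine Fin.cases h0 hs i
  · intro x hx
    obtain ⟨h1, h2⟩ := hx
    rw [abs_le] at h2
    have h1' : ∀ i, -(n : ℤ) ≤ x i ∧ x i ≤ n := fun i => abs_le.1 (h1 i)
    refine ⟨Fin.cons ((n : ℤ) - ∑ i, x i).toNat (fun i => (x i + n).toNat), ?_, ?_⟩
    · simp only [coe_filter, Fintype.mem_piFinset, mem_range, Set.mem_ofPred_eq]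
      constructor
      · intro i
        refine Fin.cases ?_ (fun i => ?_) i
        · simp only [Fin.cons_zero]; omega
        · simp only [Fin.cons_succ]
          have := h1' i
          omega
      · rw [Fin.sum_univ_succ]
        simp only [Fin.cons_zero, Fin.cons_succ]
        zify
        rw [Int.toNat_of_nonneg (by omega)]
        have : ∀ i ∈ (univ : Finset (Fin d)), ((x i + n).toNat : ℤ) = x i + n := fun i _ => by
          have := h1' i; omega
        rw [sum_congr rfl this, sum_add_distrib]
        simp
        ring
    · funext i
      simp only [Fin.cons_succ]
      have := h1' i
      omega

open PowerSeries in
lemma card_coeff (m N s : ℕ) :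
    ((#{p ∈ Fintype.piFinset (fun _ : Fin m => range N) | ∑ i, p i = s} : ℕ) : ℚ) =
      coeff s ((∑ j ∈ range N, (X : PowerSeries ℚ) ^ j) ^ m) := by
  have h : (∑ j ∈ range N, (X : PowerSeries ℚ) ^ j) ^ m =
      ∑ p ∈ Fintype.piFinset (fun _ : Fin m => range N), X ^ (∑ i, p i) := by
    have := prod_univ_sum (fun _ : Fin m => range N) (fun _ j => (X : PowerSeries ℚ) ^ j)
    rw [prod_const, card_univ, Fintype.card_fin] at this
    rw [this]
    simp [prod_pow_eq_pow_sum]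
  rw [h, map_sum]
  simp only [coeff_X_pow, card_filter]
  push_cast
  refine sum_congr rfl fun p _ => ?_
  simp only [eq_comm]

open PowerSeries in
lemma coeff_formula (d N s : ℕ) :
    coeff s ((∑ j ∈ range N, (X : PowerSeries ℚ) ^ j) ^ (d + 1)) =
    ∑ k ∈ range (d + 2), (-1 : ℚ) ^ k * ((d + 1).choose k) *
      (if k * N ≤ s then ((d + (s - k * N)).choose d : ℚ) else 0) := by
  have h1 : (∑ j ∈ range N, (X : PowerSeries ℚ) ^ j) ^ (d + 1) =
      (1 - X ^ N) ^ (d + 1) * (PowerSeries.mk fun n => (Nat.choose (d + n) d : ℚ)) := by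
    have h2 : (∑ j ∈ range N, (X : PowerSeries ℚ) ^ j) * (1 - X) = 1 - X ^ N := geom_sum_mul_neg _ _
    rw [← h2, mul_pow, mul_assoc, mul_comm ((1 - X : PowerSeries ℚ) ^ (d + 1)),
      mk_add_choose_mul_one_sub_pow_eq_one, mul_one]
  rw [h1, sub_eq_neg_add, add_pow, sum_mul, map_sum]
  refine sum_congr rfl fun k _ => ?_
  have : (-(X : PowerSeries ℚ) ^ N) ^ k * 1 ^ (d + 1 - k) * ((d + 1).choose k : PowerSeries ℚ) *
      (PowerSeries.mk fun n => (Nat.choose (d + n) d : ℚ)) =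
      C ((-1 : ℚ) ^ k * ((d + 1).choose k)) * (X ^ (k * N) * (PowerSeries.mk fun n => (Nat.choose (d + n) d : ℚ))) := by
    rw [neg_pow, ← pow_mul, mul_comm N k]
    simp
    ring
  rw [this, coeff_C_mul, coeff_X_pow_mul']
  simp only [coeff_mk]

lemma cyc_formula (d n : ℕ) : (cycCount d n : ℚ) =
    ∑ k ∈ range (d / 2 + 1), (-1 : ℚ) ^ k * ((d + 1).choose k) / (d.factorial : ℚ) *
      ∏ i ∈ range d, (((d : ℚ) + 1 - 2 * k) * n + ((i : ℚ) + 1 - k)) := by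
  rw [cyc_card, card_coeff, coeff_formula]
  symm
  have hsub : range (d / 2 + 1) ⊆ range (d + 2) := range_subset_range.2 (by omega)
  rw [← sum_subset hsub]
  · refine sum_congr rfl fun k hk => ?_
    have hk' : 2 * k ≤ d := by have := mem_range.1 hk; omega
    obtain ⟨r, hr⟩ := Nat.exists_eq_add_of_le hk'
    rw [div_mul_eq_mul_div, mul_div_assoc]
    congr 1
    split_ifs with h
    · obtain ⟨s, hs⟩ := Nat.exists_eq_add_of_le h
      rw [hs, Nat.add_sub_cancel_left, add_comm d s, div_eq_iff (by positivity)]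
      have hs' : ((d : ℚ) + 1) * n = k * (2 * n + 1) + s := by exact_mod_cast hs
      have := Nat.ascFactorial_eq_factorial_mul_choose s d
      rw [Nat.ascFactorial_eq_prod_range] at this
      have h2 : ((∏ i ∈ range d, (s + 1 + i) : ℕ) : ℚ) = (d.factorial : ℚ) * ((s + d).choose d) := by
        exact_mod_cast this
      rw [mul_comm ((s + d).choose d : ℚ), ← h2]
      push_cast
      refine prod_congr rfl fun i _ => ?_
      linear_combination hs'
    · rw [prod_eq_zero_iff.2, zero_div]
      push Not at h
      subst hr
      have h3 : (r + 1) * n < k := by nlinarith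
      refine ⟨k - (r + 1) * n - 1, mem_range.2 (by omega), ?_⟩
      have h4 : ((k - (r + 1) * n - 1 : ℕ) : ℚ) = k - (r + 1) * n - 1 := by
        rw [Nat.cast_sub (by omega), Nat.cast_sub (by omega)]; push_cast; ring
      rw [h4]
      push_cast
      ring
  · intro k _ hk
    have hk' : d + 1 ≤ 2 * k := by
      simp only [mem_range] at hk; omega
    rw [if_neg, mul_zero]
    push Not
    have : (d + 1) * n ≤ 2 * k * n := Nat.mul_le_mul_right _ hk'
    nlinarith

open Polynomial in
lemma coeff_prod_lin (α : ℚ) (β : ℕ → ℚ) (n : ℕ) (hβ : ∀ i < n, β i ≠ 0) :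
    (∏ i ∈ range n, (C α * X + C (β i))).coeff 0 = ∏ i ∈ range n, β i ∧
    (∏ i ∈ range n, (C α * X + C (β i))).coeff 1 =
      (∏ i ∈ range n, β i) * (α * ∑ i ∈ range n, 1 / β i) ∧
    (∏ i ∈ range n, (C α * X + C (β i))).coeff 2 =
      (∏ i ∈ range n, β i) * (α ^ 2 * (((∑ i ∈ range n, 1 / β i) ^ 2
        - ∑ i ∈ range n, 1 / β i ^ 2) / 2)) := by
  induction n with
  | zero => simp [coeff_one]
  | succ n ih =>
    obtain ⟨h0, h1, h2⟩ := ih (fun i hi => hβ i (by omega))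
    have hb := hβ n (by omega)
    simp only [prod_range_succ, sum_range_succ]
    set Q := ∏ i ∈ range n, (C α * X + C (β i)) with hQ
    have e : Q * (C α * X + C (β n)) = C α * (Q * X) + C (β n) * Q := by ring
    rw [e]
    simp only [coeff_add, coeff_C_mul, coeff_mul_X, coeff_mul_X_zero, h0, h1, h2]
    refine ⟨by ring, ?_, ?_⟩
    · field_simp
      ring
    · field_simp
      ring

/-- the k-th summand of the counting polynomial -/
noncomputable def cterm (d k : ℕ) : Polynomial ℚ :=
  Polynomial.C ((-1 : ℚ) ^ k * ((d + 1).choose k) / (d.factorial : ℚ)) *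
    ∏ i ∈ range d, (Polynomial.C ((d : ℚ) + 1 - 2 * k) * Polynomial.X + Polynomial.C ((i : ℚ) + 1 - k))

lemma prod_fact (n : ℕ) : ∏ i ∈ range n, ((i : ℚ) + 1) = n.factorial := by
  induction n with
  | zero => simp
  | succ n ih => rw [prod_range_succ, ih, Nat.factorial_succ]; push_cast; ring

lemma sum_harm (n : ℕ) : ∑ i ∈ range n, 1 / ((i : ℚ) + 1) = harmonic n := by
  simp [harmonic]

lemma cterm_zero (d : ℕ) : (cterm d 0).coeff 0 = 1 ∧
    (cterm d 0).coeff 1 = ((d : ℚ) + 1) * harmonic d ∧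
    (cterm d 0).coeff 2 = ((d : ℚ) + 1) ^ 2 * e2s d := by
  obtain ⟨h0, h1, h2⟩ := coeff_prod_lin ((d : ℚ) + 1) (fun i => (i : ℚ) + 1) d
    (fun i _ => by positivity)
  have e : cterm d 0 = Polynomial.C (1 / (d.factorial : ℚ)) *
      ∏ i ∈ range d, (Polynomial.C ((d : ℚ) + 1) * Polynomial.X + Polynomial.C ((i : ℚ) + 1)) := by
    simp [cterm]
  have hf : (d.factorial : ℚ) ≠ 0 := by positivity
  rw [e]
  simp only [Polynomial.coeff_C_mul, h0, h1, h2, prod_fact, sum_harm]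
  refine ⟨by field_simp, by field_simp, ?_⟩
  rw [e2s, zsum]
  field_simp

lemma sum_neg_harm (k : ℕ) : ∑ i ∈ range k, 1 / ((i : ℚ) - k) = - harmonic k := by
  rw [← sum_range_reflect, ← sum_harm, ← sum_neg_distrib]
  refine sum_congr rfl fun i hi => ?_
  have := mem_range.1 hi
  rw [Nat.cast_sub (by omega), Nat.cast_sub (by omega)]
  rw [← one_div_neg_eq_neg_one_div]
  congr 1
  push_cast
  ring

lemma prod_neg_fact (k : ℕ) : ∏ i ∈ range k, ((i : ℚ) - k) = (-1) ^ k * k.factorial := by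
  rw [← prod_range_reflect, ← prod_fact]
  have : (-1 : ℚ) ^ k = ∏ i ∈ range k, (-1 : ℚ) := by simp
  rw [this, ← prod_mul_distrib]
  refine prod_congr rfl fun i hi => ?_
  have := mem_range.1 hi
  rw [Nat.cast_sub (by omega), Nat.cast_sub (by omega)]
  push_cast
  ring

lemma cterm_succ (k r : ℕ) : (cterm (k + 1 + r) (k + 1)).coeff 0 = 0 ∧
    (cterm (k + 1 + r) (k + 1)).coeff 1 =
      -((k : ℚ) + 1 + r + 1) * (1 / ((k : ℚ) + 1) - 1 / ((r : ℚ) + 1)) ∧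
    (cterm (k + 1 + r) (k + 1)).coeff 2 =
      -((k : ℚ) + 1 + r + 1) * (((k : ℚ) + 1 + r + 1) * (1 / ((k : ℚ) + 1) + 1 / ((r : ℚ) + 1)) - 4) *
        (harmonic r - harmonic k) := by
  set α : ℚ := (r : ℚ) - k with hα
  obtain ⟨h0, h1, -⟩ := coeff_prod_lin α (fun i => (i : ℚ) - k) k
    (fun i hi => by
      have : (i : ℚ) < k := by exact_mod_cast hi
      intro h; linarith)
  obtain ⟨g0, g1, -⟩ := coeff_prod_lin α (fun i => (i : ℚ) + 1) r
    (fun i _ => by positivity)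
  simp only [sum_harm, prod_fact, sum_neg_harm, prod_neg_fact] at h0 h1 g0 g1
  set A := ∏ i ∈ range k, (Polynomial.C α * Polynomial.X + Polynomial.C ((i : ℚ) - k)) with hA
  set B := ∏ i ∈ range r, (Polynomial.C α * Polynomial.X + Polynomial.C ((i : ℚ) + 1)) with hB
  set c : ℚ := (-1 : ℚ) ^ (k + 1) * ((k + 1 + r + 1).choose (k + 1)) / ((k + 1 + r).factorial : ℚ)
    with hc
  have e : cterm (k + 1 + r) (k + 1) = Polynomial.C (c * α) * (A * B * Polynomial.X) := by
    rw [cterm, prod_range_add, prod_range_succ]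
    have e1 : (((k + 1 + r : ℕ) : ℚ) + 1 - 2 * ((k + 1 : ℕ) : ℚ)) = α := by
      rw [hα]; push_cast; ring
    have e2 : ∀ i : ℕ, (i : ℚ) + 1 - ((k + 1 : ℕ) : ℚ) = i - k := fun i => by push_cast; ring
    have e3 : ∀ i : ℕ, ((k + 1 + i : ℕ) : ℚ) - k = i + 1 := fun i => by push_cast; ring
    simp only [e1, e2, e3, sub_self, Polynomial.C_0, add_zero]
    rw [Polynomial.C_mul]
    ring
  have hcv : c * ((-1) ^ k * k.factorial * r.factorial) =
      -((k : ℚ) + 1 + r + 1) / (((k : ℚ) + 1) * (r + 1)) := by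
    have h := Nat.add_choose_mul_factorial_mul_factorial (k + 1) (r + 1)
    rw [show k + 1 + (r + 1) = k + 1 + r + 1 by ring, Nat.factorial_succ k, Nat.factorial_succ r,
      Nat.factorial_succ (k + 1 + r),
      ← Nat.choose_symm_of_eq_add (show k + 1 + r + 1 = (k + 1) + (r + 1) by ring)] at h
    have h' : ((k + 1 + r + 1).choose (k + 1) : ℚ) * (((k : ℚ) + 1) * k.factorial) *
      (((r : ℚ) + 1) * r.factorial) = ((k : ℚ) + 1 + r + 1) * (k + 1 + r).factorial := by
      exact_mod_cast h
    have hf : ((k + 1 + r).factorial : ℚ) ≠ 0 := by positivity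
    have hs : (-1 : ℚ) ^ k * (-1) ^ k = 1 := by rw [← mul_pow]; simp
    rw [hc, pow_succ]
    rw [div_mul_eq_mul_div, div_eq_div_iff hf (by positivity)]
    linear_combination (-((-1 : ℚ) ^ k * (-1) ^ k)) * h' -
      ((k : ℚ) + 1 + r + 1) * (k + 1 + r).factorial * hs
  have hAB1 : (A * B).coeff 1 = A.coeff 0 * B.coeff 1 + A.coeff 1 * B.coeff 0 := by
    rw [Polynomial.coeff_mul]
    simp [Finset.Nat.antidiagonal_succ]
  rw [e]
  refine ⟨by simp, ?_⟩
  simp only [Polynomial.coeff_C_mul, Polynomial.coeff_mul_X,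
    hAB1, Polynomial.mul_coeff_zero, h0, h1, g0, g1]
  have k1 : (k : ℚ) + 1 ≠ 0 := by positivity
  have r1 : (r : ℚ) + 1 ≠ 0 := by positivity
  constructor
  · have : c * α * ((-1) ^ k * k.factorial * r.factorial) =
        -((k : ℚ) + 1 + r + 1) / (((k : ℚ) + 1) * (r + 1)) * α := by
      rw [← hcv]; ring
    rw [this, hα]
    field_simp
    ring
  · have : c * α * ((-1) ^ k * k.factorial * (r.factorial * (α * harmonic r)) +
        (-1) ^ k * k.factorial * (α * -harmonic k) * r.factorial) =
        -((k : ℚ) + 1 + r + 1) / (((k : ℚ) + 1) * (r + 1)) * α ^ 2 * (harmonic r - harmonic k) := by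
      rw [← hcv]; ring
    rw [this, hα]
    field_simp
    ring

/-- the counting polynomial -/
noncomputable def cpoly (d : ℕ) : Polynomial ℚ := ∑ k ∈ range (d / 2 + 1), cterm d k

lemma cpoly_coeff (d : ℕ) : (cpoly d).coeff 0 = 1 ∧
    (cpoly d).coeff 1 =
      2 * ((d : ℚ) + 1) * (harmonic (2 * ((d + 1) / 2)) - harmonic ((d + 1) / 2)) ∧
    (cpoly d).coeff 2 =
      4 * (d + 1) * d * (harmonic (2 * ((d + 1) / 2)) - harmonic ((d + 1) / 2))
       - ((d : ℚ) + 1) ^ 2 * zsum ((d + 1) / 2) := by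
  obtain ⟨h0, h1, h2⟩ := cterm_zero d
  have key : ∀ k ∈ range (d / 2), (cterm d (k + 1)).coeff 0 = 0 ∧
    (cterm d (k + 1)).coeff 1 =
      -((d : ℚ) + 1) * (1 / ((k : ℚ) + 1) - 1 / ((d : ℚ) - k)) ∧
    (cterm d (k + 1)).coeff 2 =
      -((d : ℚ) + 1) ^ 2 * ((1 / ((k : ℚ) + 1) + 1 / ((d : ℚ) - k)) *
        (harmonic (d - (k + 1)) - harmonic k)) +
      4 * (d + 1) * (harmonic (d - (k + 1)) - harmonic k) := by
    intro k hk
    have hk' := mem_range.1 hk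
    obtain ⟨r, rfl⟩ := Nat.exists_eq_add_of_le (show k + 1 ≤ d by omega)
    obtain ⟨t0, t1, t2⟩ := cterm_succ k r
    rw [t0, t1, t2, Nat.add_sub_cancel_left]
    push_cast
    rw [show (k : ℚ) + 1 + r - k = r + 1 by ring]
    exact ⟨rfl, rfl, by ring⟩
  rw [cpoly, sum_range_succ']
  simp only [Polynomial.coeff_add, Polynomial.finsetSum_coeff]
  rw [h0, h1, h2]
  refine ⟨?_, ?_, ?_⟩
  · rw [sum_eq_zero fun k hk => (key k hk).1, zero_add]
  · rw [sum_congr rfl fun k hk => (key k hk).2.1, ← mul_sum]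
    linear_combination ((d : ℚ) + 1) * closed1 d
  · rw [sum_congr rfl fun k hk => (key k hk).2.2, sum_add_distrib, ← mul_sum, ← mul_sum]
    linear_combination closed2 d

lemma cpoly_eval (d : ℕ) (x : ℚ) : (cpoly d).eval x =
    ∑ k ∈ range (d / 2 + 1), (-1 : ℚ) ^ k * ((d + 1).choose k) / (d.factorial : ℚ) *
      ∏ i ∈ range d, (((d : ℚ) + 1 - 2 * k) * x + ((i : ℚ) + 1 - k)) := by
  simp [cpoly, cterm, Polynomial.eval_finsetSum, Polynomial.eval_prod]

lemma cpoly_symm (d : ℕ) (x : ℚ) : (cpoly d).eval (-1 - x) = (-1) ^ d * (cpoly d).eval x := by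
  rw [cpoly_eval, cpoly_eval, mul_sum]
  refine sum_congr rfl fun k _ => ?_
  rw [mul_left_comm]
  congr 1
  rw [← prod_range_reflect]
  have : (-1 : ℚ) ^ d = ∏ i ∈ range d, (-1 : ℚ) := by simp
  rw [this, ← prod_mul_distrib]
  refine prod_congr rfl fun i hi => ?_
  have := mem_range.1 hi
  rw [Nat.cast_sub (by omega), Nat.cast_sub (by omega)]
  push_cast
  ring

open Polynomial in
lemma half (d : ℕ) (hd : 2 ≤ d) (a : ℕ → ℚ)
    (ha : cpoly d = ∑ j ∈ range (d + 1), C (a j) * (X ^ j * (1 + X) ^ (d - j))) :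
    0 < a 0 ∧ 0 < a 1 ∧ 0 < a 2 := by
  obtain ⟨h0, h1, h2⟩ := cpoly_coeff d
  obtain ⟨e, rfl⟩ := Nat.exists_eq_add_of_le' hd
  have hc : ∀ t, t ≤ 2 → (cpoly (e + 2)).coeff t = ∑ j ∈ range 3, a j *
      (if j ≤ t then ((e + 2 - j).choose (t - j) : ℚ) else 0) := by
    intro t ht
    rw [ha, finsetSum_coeff]
    simp only [coeff_C_mul, coeff_X_pow_mul', coeff_one_add_X_pow]
    symm
    apply sum_subset (range_subset_range.2 (by omega))
    intro j _ hj
    rw [if_neg, mul_zero]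
    simp only [mem_range] at hj
    omega
  rw [hc _ (by norm_num)] at h0 h1 h2
  have hch : ((e + 2).choose 2 : ℚ) = (e + 2) * (e + 1) / 2 := by
    rw [Nat.cast_choose_two]; push_cast; ring
  simp [sum_range_succ, hch] at h0 h1 h2
  have f1 := final1 (e + 2) hd
  have f2 := final2 (e + 2) hd
  push_cast at f1 f2
  rw [h0] at h1 h2
  refine ⟨by rw [h0]; norm_num, by linarith, ?_⟩
  have ha1 : a 1 = 2 * ((e : ℚ) + 2 + 1) * (harmonic (2 * ((e + 2 + 1) / 2)) -
    harmonic ((e + 2 + 1) / 2)) - (e + 2) := by linarith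
  rw [ha1] at h2
  linarith

/-- In the expansion `Cyc_d(n) = Σ_j a_j n^j (1+n)^{d-j}`, the coefficients
`a_0, a_1, a_2, a_{d-2}, a_{d-1}, a_d` are positive. -/
theorem cycle_dual_outer_coeffs_positive (d : ℕ) (hd : 2 ≤ d) (a : ℕ → ℚ)
    (ha : ∀ n : ℕ, (cycCount d n : ℚ) =
      ∑ j ∈ Finset.range (d + 1), a j * (n : ℚ) ^ j * (1 + (n : ℚ)) ^ (d - j)) :
    0 < a 0 ∧ 0 < a 1 ∧ 0 < a 2 ∧ 0 < a (d - 2) ∧ 0 < a (d - 1) ∧ 0 < a d := by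
  have hev : ∀ (b : ℕ → ℚ) (x : ℚ), Polynomial.eval x (∑ j ∈ range (d + 1), Polynomial.C (b j) *
      (Polynomial.X ^ j * (1 + Polynomial.X) ^ (d - j))) =
      ∑ j ∈ range (d + 1), b j * x ^ j * (1 + x) ^ (d - j) := by
    intro b x
    simp [Polynomial.eval_finsetSum, mul_assoc]
  have h1 : cpoly d = ∑ j ∈ range (d + 1), Polynomial.C (a j) *
      (Polynomial.X ^ j * (1 + Polynomial.X) ^ (d - j)) := by
    apply Polynomial.eq_of_infinite_eval_eq
    apply (Set.infinite_range_of_injective (Nat.cast_injective (R := ℚ))).mono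
    rintro _ ⟨n, rfl⟩
    show Polynomial.eval (n : ℚ) _ = Polynomial.eval (n : ℚ) _
    rw [hev, ← ha n, cyc_formula, cpoly_eval]
  have h2 : cpoly d = ∑ j ∈ range (d + 1), Polynomial.C (a (d - j)) *
      (Polynomial.X ^ j * (1 + Polynomial.X) ^ (d - j)) := by
    apply Polynomial.funext
    intro x
    rw [hev (fun j => a (d - j))]
    have hs := cpoly_symm d x
    have hone : (-1 : ℚ) ^ d * (-1) ^ d = 1 := by rw [← mul_pow]; simp
    have hx : (cpoly d).eval x = (-1) ^ d * (cpoly d).eval (-1 - x) := by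
      rw [hs, ← mul_assoc, hone, one_mul]
    rw [hx, h1, hev, mul_sum, ← sum_range_reflect]
    refine sum_congr rfl fun j hj => ?_
    have hj' : j ≤ d := by have := mem_range.1 hj; omega
    rw [show d + 1 - 1 - j = d - j by omega, show d - (d - j) = j by omega,
      show (-1 - x) = (-1) * (1 + x) by ring, show 1 + (-1) * (1 + x) = (-1) * x by ring,
      mul_pow, mul_pow]
    have hm : (-1 : ℚ) ^ (d - j) * (-1) ^ j = (-1) ^ d := by
      rw [← pow_add]; congr 1; omega
    linear_combination (-1 : ℚ) ^ d * a (d - j) * (1 + x) ^ (d - j) * x ^ j * hm +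
      a (d - j) * (1 + x) ^ (d - j) * x ^ j * hone
  obtain ⟨p0, p1, p2⟩ := half d hd a h1
  obtain ⟨q0, q1, q2⟩ := half d hd (fun j => a (d - j)) h2
  exact ⟨p0, p1, p2, q2, q1, by simpa using q0⟩
end

section
/- Let d ≥ 1 and let a_0, a_1, …, a_d be rational numbers such that Cyc_d(n) = Σ_{j=0}^{d} a_j · n^j · (1+n)^{d−j} for all natural numbers n. Then a_j = a_{d−j} for all 0 ≤ j ≤ d. -/
open Polynomial in
lemma aux_indep (d : ℕ) (c : ℕ → ℚ)
    (h : ∀ x : ℚ, ∑ j ∈ Finset.range (d + 1), c j * x ^ j * (1 + x) ^ (d - j) = 0) :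
    ∀ j ≤ d, c j = 0 := by
  have key : (∑ j ∈ Finset.range (d + 1), C (c j) * X ^ j : ℚ[X]) = 0 := by
    apply Polynomial.eq_of_infinite_eval_eq
    apply Set.Infinite.mono (s := {1}ᶜ)
    · intro t ht
      have ht1 : (1 - t) ≠ 0 := by
        intro h0
        exact ht (by simp; linarith)
      have h2 := h (t / (1 - t))
      have h3 : (1 : ℚ) + t / (1 - t) = (1 - t)⁻¹ := by field_simp; ring
      rw [h3] at h2
      have h4 : (1 - t) ^ d * ∑ j ∈ Finset.range (d + 1),
          c j * (t / (1 - t)) ^ j * ((1 - t)⁻¹) ^ (d - j) = 0 := by rw [h2, mul_zero]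
      rw [Finset.mul_sum] at h4
      simp only [Set.mem_ofPred_eq, eval_finsetSum, eval_mul, eval_C, eval_pow, eval_X, eval_zero]
      rw [← h4]
      apply Finset.sum_congr rfl
      intro j hj
      have hj' : j ≤ d := by simp at hj; omega
      obtain ⟨e, rfl⟩ := Nat.exists_eq_add_of_le hj'
      rw [Nat.add_sub_cancel_left, pow_add, div_pow, inv_pow]
      field_simp
    · exact (Set.finite_singleton (1 : ℚ)).infinite_compl
  intro j hj
  have := congrArg (fun p => Polynomial.coeff p j) key
  simpa [Polynomial.finsetSum_coeff, Polynomial.coeff_C_mul, Polynomial.coeff_X_pow,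
    Nat.lt_succ_iff, hj] using this

lemma aux_bij (d n : ℕ) : cycCount d n =
    ((Fintype.piFinset (fun _ : Fin (d + 1) => Finset.range (2 * n + 1))).filter
      (fun f => ∑ i, f i = (d + 1) * n)).card := by
  unfold cycCount
  rw [← Set.ncard_coe_finset]
  symm
  apply Set.ncard_congr (fun f _ => fun i : Fin d => ((f i.succ : ℤ) - n))
  · intro f hf
    simp only [Finset.coe_filter, Fintype.mem_piFinset, Finset.mem_range, Set.mem_ofPred_eq] at hf ⊢
    obtain ⟨h1, h2⟩ := hf
    refine ⟨fun i => ?_, ?_⟩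
    · have := h1 i.succ
      rw [abs_le]; constructor <;> omega
    · rw [Fin.sum_univ_succ] at h2
      have h3 := h1 0
      rw [Finset.sum_sub_distrib]
      simp only [Finset.sum_const, Finset.card_univ, Fintype.card_fin, nsmul_eq_mul]
      have h2' : (f 0 : ℤ) + ∑ i : Fin d, (f i.succ : ℤ) = (d + 1) * n := by exact_mod_cast h2
      have h3' : (f 0 : ℤ) < 2 * n + 1 := by exact_mod_cast h3
      rw [abs_le]; constructor <;> nlinarith
  · intro f g hf hg hfg
    simp only [Finset.coe_filter, Fintype.mem_piFinset, Finset.mem_range, Set.mem_ofPred_eq] at hf hg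
    have hs : ∀ i : Fin d, f i.succ = g i.succ := by
      intro i
      have := congrFun hfg i
      omega
    have h2 := hf.2.trans hg.2.symm
    rw [Fin.sum_univ_succ, Fin.sum_univ_succ, Finset.sum_congr rfl (fun i _ => hs i)] at h2
    funext i
    refine Fin.cases ?_ hs i
    omega
  · intro x hx
    obtain ⟨h1, h2⟩ := hx
    simp only [abs_le] at h1 h2
    refine ⟨Fin.cons (n - ∑ i, x i).toNat (fun i => (x i + n).toNat), ?_, ?_⟩
    · simp only [Finset.coe_filter, Fintype.mem_piFinset, Finset.mem_range, Set.mem_ofPred_eq]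
      constructor
      · intro i
        refine Fin.cases ?_ (fun i => ?_) i
        · simp only [Fin.cons_zero]; omega
        · simp only [Fin.cons_succ]; have := h1 i; omega
      · rw [Fin.sum_univ_succ]
        simp only [Fin.cons_zero, Fin.cons_succ]
        zify
        rw [Int.toNat_of_nonneg (by omega),
          Finset.sum_congr rfl (fun i _ => Int.toNat_of_nonneg (by have := h1 i; omega)),
          Finset.sum_add_distrib]
        simp
        ring
    · funext i
      simp only [Fin.cons_succ]
      have := h1 i; omega

open PowerSeries in
lemma aux_coeff (m N e : ℕ) :
    (((Fintype.piFinset (fun _ : Fin m => Finset.range N)).filter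
      (fun f => ∑ i, f i = e)).card : ℚ) =
    coeff e ((∑ i ∈ Finset.range N, (X : ℚ⟦X⟧) ^ i) ^ m) := by
  have : (∑ i ∈ Finset.range N, (X : ℚ⟦X⟧) ^ i) ^ m =
      ∏ _i : Fin m, ∑ i ∈ Finset.range N, (X : ℚ⟦X⟧) ^ i := by simp
  rw [this, Finset.prod_univ_sum, map_sum, Finset.card_filter]
  push_cast
  apply Finset.sum_congr rfl
  intro f _
  rw [Finset.prod_pow_eq_pow_sum, coeff_X_pow]
  simp [eq_comm]

open PowerSeries in
lemma aux_coeff2 (d N e : ℕ) :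
    coeff e ((∑ i ∈ Finset.range N, (X : ℚ⟦X⟧) ^ i) ^ (d + 1)) =
    ∑ k ∈ Finset.range (d + 2), if N * k ≤ e then
      (-1 : ℚ) ^ k * (d + 1).choose k * ((d + (e - N * k)).choose d : ℚ) else 0 := by
  have h1 : (∑ i ∈ Finset.range N, (X : ℚ⟦X⟧) ^ i) ^ (d + 1) =
      (1 - X ^ N) ^ (d + 1) * (PowerSeries.mk fun n => ((d + n).choose d : ℚ)) := by
    have h2 := PowerSeries.mk_add_choose_mul_one_sub_pow_eq_one ℚ d
    have h3 : (1 - X ^ N : ℚ⟦X⟧) = (∑ i ∈ Finset.range N, (X : ℚ⟦X⟧) ^ i) * (1 - X) := by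
      rw [geom_sum_mul_neg]
    rw [h3, mul_pow, mul_assoc, mul_comm ((1 - X) ^ (d + 1)), h2, mul_one]
  rw [h1, sub_eq_add_neg, add_comm, add_pow, Finset.sum_mul, map_sum]
  apply Finset.sum_congr rfl
  intro k _
  have h4 : ((-X ^ N : ℚ⟦X⟧)) ^ k * 1 ^ (d + 1 - k) * ((d + 1).choose k : ℚ⟦X⟧) *
      (PowerSeries.mk fun n => ((d + n).choose d : ℚ)) =
      C ((-1 : ℚ) ^ k * (d + 1).choose k) *
        (X ^ (N * k) * PowerSeries.mk fun n => ((d + n).choose d : ℚ)) := by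
    rw [neg_pow, one_pow, ← pow_mul]
    simp only [map_mul, map_pow, map_neg, map_one, map_natCast]
    ring
  rw [h4, coeff_C_mul, coeff_X_pow_mul']
  split_ifs <;> simp

lemma aux_choose (d x : ℕ) :
    ((d + x).choose d : ℚ) = (∏ i ∈ Finset.range d, ((x : ℚ) + 1 + i)) / d.factorial := by
  have h := Nat.ascFactorial_eq_factorial_mul_choose x d
  rw [Nat.ascFactorial_eq_prod_range] at h
  have h2 := congrArg (Nat.cast : ℕ → ℚ) h
  push_cast at h2
  rw [h2, add_comm d x]
  field_simp

/-- The polynomial form of the count. -/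
noncomputable def auxR (d : ℕ) : Polynomial ℚ :=
  ∑ k ∈ Finset.range (d + 2), if 2 * k < d + 1 then
    Polynomial.C ((-1 : ℚ) ^ k * (d + 1).choose k / d.factorial) *
    ∏ i ∈ Finset.range d, (((d : Polynomial ℚ) + 1 - 2 * (k : Polynomial ℚ)) * Polynomial.X - (k : Polynomial ℚ) + 1 +
      (i : Polynomial ℚ)) else 0

lemma auxR_eval (d : ℕ) (x : ℚ) : (auxR d).eval x =
  ∑ k ∈ Finset.range (d + 2), if 2 * k < d + 1 then
    ((-1 : ℚ) ^ k * (d + 1).choose k / d.factorial) *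
    ∏ i ∈ Finset.range d, (((d : ℚ) + 1 - 2 * k) * x - k + 1 + i) else 0 := by
  unfold auxR
  rw [Polynomial.eval_finsetSum]
  apply Finset.sum_congr rfl
  intro k _
  split_ifs
  · rw [Polynomial.eval_mul, Polynomial.eval_C, Polynomial.eval_prod]
    simp
  · simp

lemma auxR_symm (d : ℕ) (x : ℚ) : (auxR d).eval (-1 - x) = (-1) ^ d * (auxR d).eval x := by
  rw [auxR_eval, auxR_eval, Finset.mul_sum]
  apply Finset.sum_congr rfl
  intro k _
  split_ifs
  · rw [mul_left_comm]
    congr 1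
    rw [← Finset.prod_range_reflect]
    have hc : (-1 : ℚ) ^ d = ∏ _i ∈ Finset.range d, (-1 : ℚ) := by simp
    rw [hc, ← Finset.prod_mul_distrib]
    apply Finset.prod_congr rfl
    intro i hi
    have hi' : i < d := by simpa using hi
    have : ((d - 1 - i : ℕ) : ℚ) = d - 1 - i := by
      rw [Nat.sub_sub, Nat.cast_sub (by omega)]; push_cast; ring
    rw [this]
    ring
  · simp

lemma auxR_count (d n : ℕ) (hd : 1 ≤ d) (hn : d + 1 ≤ n) :
    (cycCount d n : ℚ) = (auxR d).eval (n : ℚ) := by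
  rw [aux_bij, aux_coeff, aux_coeff2, auxR_eval]
  apply Finset.sum_congr rfl
  intro k hk
  have hiff : (2 * n + 1) * k ≤ (d + 1) * n ↔ 2 * k < d + 1 := by
    constructor
    · intro h
      by_contra h2
      push Not at h2
      have hk0 : 0 < k := by omega
      nlinarith
    · intro h
      nlinarith
  simp only [hiff]
  split_ifs with h
  · rw [aux_choose, Nat.cast_sub (hiff.2 h)]
    push_cast
    rw [mul_div_assoc', div_mul_eq_mul_div]
    congr 2
    apply Finset.prod_congr rfl
    intro i _
    ring
  · rfl

/-- In the expansion `Cyc_d(n) = Σ_j a_j n^j (1+n)^{d-j}`, the coefficients are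
palindromic: `a_j = a_{d-j}` (reflexivity of the polytope). -/
theorem cycle_dual_coeffs_palindromic (d : ℕ) (hd : 1 ≤ d) (a : ℕ → ℚ)
    (ha : ∀ n : ℕ, (cycCount d n : ℚ) =
      ∑ j ∈ Finset.range (d + 1), a j * (n : ℚ) ^ j * (1 + (n : ℚ)) ^ (d - j)) :
    ∀ j ≤ d, a j = a (d - j) := by
  have hQ : (∑ j ∈ Finset.range (d + 1), Polynomial.C (a j) * Polynomial.X ^ j *
      (1 + Polynomial.X) ^ (d - j) : Polynomial ℚ) = auxR d := by
    apply Polynomial.eq_of_infinite_eval_eq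
    apply Set.Infinite.mono (s := (Nat.cast : ℕ → ℚ) '' Set.Ici (d + 1))
    · rintro _ ⟨n, hn, rfl⟩
      have h1 := ha n
      rw [auxR_count d n hd hn] at h1
      simp only [Set.mem_ofPred_eq]
      rw [h1]
      simp [Polynomial.eval_finsetSum]
    · exact (Set.Ici_infinite _).image Nat.cast_injective.injOn
  have hE : ∀ x : ℚ, (auxR d).eval x =
      ∑ j ∈ Finset.range (d + 1), a j * x ^ j * (1 + x) ^ (d - j) := by
    intro x
    rw [← hQ]
    simp [Polynomial.eval_finsetSum]
  have key := aux_indep d (fun j => a j - a (d - j)) (by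
    intro x
    have h1 := auxR_symm d x
    rw [hE, hE, ← Finset.sum_range_reflect] at h1
    have h2 : ∑ j ∈ Finset.range (d + 1), a (d + 1 - 1 - j) * (-1 - x) ^ (d + 1 - 1 - j) *
        (1 + (-1 - x)) ^ (d - (d + 1 - 1 - j)) =
        (-1) ^ d * ∑ j ∈ Finset.range (d + 1), a (d - j) * x ^ j * (1 + x) ^ (d - j) := by
      rw [Finset.mul_sum]
      apply Finset.sum_congr rfl
      intro j hj
      have hj' : j ≤ d := by simp at hj; omega
      obtain ⟨e, rfl⟩ := Nat.exists_eq_add_of_le hj'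
      have e1 : j + e + 1 - 1 - j = e := by omega
      have e2 : j + e - e = j := by omega
      have e3 : j + e - j = e := by omega
      have e4 : (-1 - x) = (-1) * (1 + x) := by ring
      have e5 : 1 + (-1) * (1 + x) = (-1) * x := by ring
      rw [e1, e2, e3, e4, e5, mul_pow, mul_pow, pow_add]
      ring
    rw [h2] at h1
    have h3 := mul_left_cancel₀ (pow_ne_zero d (by norm_num : (-1 : ℚ) ≠ 0)) h1
    simp only [sub_mul, Finset.sum_sub_distrib]
    rw [h3, sub_self])
  intro j hj
  exact sub_eq_zero.1 (key j hj)
end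

section
/- For all integers d ≥ 1 and natural numbers n, the number of x = (x_1,…,x_d) ∈ ℤ^d such that −n ≤ x_i + x_{i+1} + ⋯ + x_j ≤ n for all 1 ≤ i ≤ j ≤ d equals (n+1)^{d+1} − n^{d+1} = Σ_{k=0}^{d} binomial(d+1, k) · n^k. -/
theorem telescope_aux (d : ℕ) (t : Fin (d + 1) → ℤ) (i j : Fin d) (hij : i ≤ j) :
    ∑ k ∈ Finset.Icc i j, (t k.succ - t k.castSucc) = t j.succ - t i.castSucc := by
  let g : ℕ → ℤ := fun m => if h : m < d + 1 then t ⟨m, h⟩ else 0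
  have h1 : ∀ k : Fin d, t k.succ - t k.castSucc = g ((Fin.valEmbedding k) + 1) - g (Fin.valEmbedding k) := by
    intro k
    have := k.2
    simp only [g, Fin.valEmbedding_apply]
    rw [dif_pos (by omega), dif_pos (by omega)]
    rfl
  rw [Finset.sum_congr rfl (fun k _ => h1 k),
    ← Finset.sum_map (Finset.Icc i j) Fin.valEmbedding (fun m => g (m + 1) - g m),
    Fin.map_valEmbedding_Icc]
  have h2 : Finset.Icc (i : ℕ) j = Finset.Ico (i : ℕ) (j + 1) := by
    ext; simp
  rw [h2, Finset.sum_Ico_sub g (by have : (i : ℕ) ≤ j := hij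
                                   omega)]
  have := i.2
  have := j.2
  simp only [g]
  rw [dif_pos (by omega), dif_pos (by omega)]
  rfl

theorem diff_bound_aux (d n : ℕ) (t : Fin (d + 1) → ℤ)
    (h : ∀ i j : Fin d, i ≤ j →
      |∑ k ∈ Finset.Icc i j, (t k.succ - t k.castSucc)| ≤ (n : ℤ)) (a b : Fin (d + 1)) (hab : a < b) :
    |t b - t a| ≤ (n : ℤ) := by
  have hab' : (a : ℕ) < b := hab
  have hb := b.2
  have h1 : (⟨a, by omega⟩ : Fin d) ≤ ⟨b - 1, by omega⟩ := by
    rw [Fin.mk_le_mk]; omega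
  have h2 := h _ _ h1
  rw [telescope_aux d t _ _ h1] at h2
  have e1 : (⟨b - 1, by omega⟩ : Fin d).succ = b := by
    ext; simp; omega
  have e2 : (⟨a, by omega⟩ : Fin d).castSucc = a := by
    ext; simp
  rwa [e1, e2] at h2

theorem image_aux (d n : ℕ) :
    {x : Fin d → ℤ | ∀ i j : Fin d, i ≤ j → |∑ k ∈ Finset.Icc i j, x k| ≤ (n : ℤ)} =
    (fun (t : Fin (d + 1) → ℤ) (k : Fin d) => t k.succ - t k.castSucc) ''
      ((Fintype.piFinset (fun _ : Fin (d + 1) => Finset.Icc (0 : ℤ) n) \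
        Fintype.piFinset (fun _ : Fin (d + 1) => Finset.Icc (1 : ℤ) n) :
          Finset (Fin (d + 1) → ℤ)) : Set (Fin (d + 1) → ℤ)) := by
  ext x
  simp only [Set.mem_setOf_eq, Set.mem_image, Finset.mem_coe, Finset.mem_sdiff,
    Fintype.mem_piFinset, Finset.mem_Icc]
  constructor
  · intro h
    have hs : ∀ k : Fin d, x k = Fin.partialSum x k.succ - Fin.partialSum x k.castSucc := by
      intro k
      rw [Fin.partialSum_succ]; ring
    generalize Fin.partialSum x = s at hs
    have hx : x = fun k => s k.succ - s k.castSucc := funext hs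
    subst hx
    obtain ⟨a, ha⟩ := Finite.exists_min s
    refine ⟨fun b => s b - s a, ⟨fun b => ⟨by linarith [ha b], ?_⟩, fun hc => ?_⟩, ?_⟩
    · rcases lt_trichotomy a b with hab | hab | hab
      · exact (abs_le.1 (diff_bound_aux d n s h a b hab)).2
      · subst hab; simp
      · have := (abs_le.1 (diff_bound_aux d n s h b a hab)).1
        simp only; linarith
    · have := (hc a).1
      simp at this
    · funext k; simp
  · rintro ⟨t, ⟨ht, -⟩, rfl⟩ i j hij
    rw [telescope_aux d t i j hij, abs_le]
    have h1 := ht j.succ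
    have h2 := ht i.castSucc
    constructor <;> linarith [h1.1, h1.2, h2.1, h2.2]

theorem inj_aux (d n : ℕ) :
    Set.InjOn (fun (t : Fin (d + 1) → ℤ) (k : Fin d) => t k.succ - t k.castSucc)
      ((Fintype.piFinset (fun _ : Fin (d + 1) => Finset.Icc (0 : ℤ) n) \
        Fintype.piFinset (fun _ : Fin (d + 1) => Finset.Icc (1 : ℤ) n) :
          Finset (Fin (d + 1) → ℤ)) : Set (Fin (d + 1) → ℤ)) := by
  intro t ht u hu htu
  simp only [Finset.mem_coe, Finset.mem_sdiff, Fintype.mem_piFinset, Finset.mem_Icc] at ht hu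
  have hc : ∀ k : Fin (d + 1), t k - u k = t 0 - u 0 := by
    intro k
    induction k using Fin.induction with
    | zero => rfl
    | succ k ih =>
      have := congrFun htu k
      simp only at this
      linarith
  obtain ⟨ht1, ht2⟩ := ht
  obtain ⟨hu1, hu2⟩ := hu
  push Not at ht2 hu2
  obtain ⟨a, ha⟩ := ht2
  obtain ⟨b, hb⟩ := hu2
  have ha0 : t a = 0 := by
    by_contra hne
    have := ht1 a
    have := ha (by omega)
    omega
  have hb0 : u b = 0 := by
    by_contra hne
    have := hu1 b
    have := hb (by omega)
    omega
  funext k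
  have := hc k
  have := hc a
  have := hc b
  have := hu1 a
  have := ht1 b
  omega

/-- The number of lattice points of the `n`-th dilate of the dual root polytope of
type A, i.e. of `x ∈ ℤ^d` with `-n ≤ x_i + ⋯ + x_j ≤ n` for all `1 ≤ i ≤ j ≤ d`,
equals `(n+1)^{d+1} - n^{d+1} = Σ_{k=0}^d C(d+1,k) n^k`. -/
theorem typeA_dual_ehrhart (d : ℕ) (hd : 1 ≤ d) (n : ℕ) :
    ((Set.ncard {x : Fin d → ℤ |
        ∀ i j : Fin d, i ≤ j → |∑ k ∈ Finset.Icc i j, x k| ≤ (n : ℤ)} : ℕ) : ℤ) =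
      ((n : ℤ) + 1) ^ (d + 1) - (n : ℤ) ^ (d + 1) ∧
    ((n : ℤ) + 1) ^ (d + 1) - (n : ℤ) ^ (d + 1) =
      ∑ k ∈ Finset.range (d + 1), (Nat.choose (d + 1) k : ℤ) * (n : ℤ) ^ k := by
  constructor
  · rw [image_aux, Set.ncard_image_of_injOn (inj_aux d n), Set.ncard_coe_finset]
    have hsub : Fintype.piFinset (fun _ : Fin (d + 1) => Finset.Icc (1 : ℤ) n) ⊆
        Fintype.piFinset (fun _ : Fin (d + 1) => Finset.Icc (0 : ℤ) n) :=
      Fintype.piFinset_subset _ _ (fun _ => Finset.Icc_subset_Icc (by norm_num) le_rfl)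
    rw [Finset.cast_card_sdiff hsub]
    have e : ((n : ℤ) + 1).toNat = n + 1 := by omega
    simp [Fintype.card_piFinset, e]
  · rw [add_pow, Finset.sum_range_succ]
    simp [mul_comm]
end

section
/- For all integers d ≥ 1 and natural numbers n, the number of x = (x_1,…,x_d) ∈ ℤ^d such that −n ≤ x_d ≤ n, −n ≤ x_i + x_{i+1} + ⋯ + x_{j−1} ≤ n for all 1 ≤ i < j ≤ d, and −n ≤ 2x_i + 2x_{i+1} + ⋯ + 2x_{d−1} + x_d ≤ n for all 1 ≤ i ≤ d−1, equals (n+1)^d + n^d. -/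
lemma last_lt {d : ℕ} (hd : 1 ≤ d) : d - 1 < d := by omega

/-- Tail sums over coordinates `k ≥ i` other than the last one. -/
def tailSum {d : ℕ} (x : Fin d → ℤ) (i : ℕ) : ℤ :=
  ∑ k ∈ Finset.univ.filter (fun k : Fin d => i ≤ k.val ∧ k.val + 2 ≤ d), x k

lemma tailSum_split {d : ℕ} (x : Fin d → ℤ) (i j : Fin d) (hij : i ≤ j) (hj : j.val + 2 ≤ d) :
    tailSum x i.val = ∑ k ∈ Finset.Icc i j, x k + tailSum x (j.val + 1) := by
  unfold tailSum
  rw [← Finset.sum_union]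
  · congr 1
    ext k
    simp only [Finset.mem_filter, Finset.mem_univ, true_and, Finset.mem_union, Finset.mem_Icc,
      Fin.le_def] at *
    omega
  · rw [Finset.disjoint_left]
    intro k
    simp only [Finset.mem_filter, Finset.mem_univ, true_and, Finset.mem_Icc, Fin.le_def]
    omega

lemma tailSum_step {d : ℕ} (x : Fin d → ℤ) (i : Fin d) (hi : i.val + 2 ≤ d) :
    tailSum x i.val = x i + tailSum x (i.val + 1) := by
  rw [tailSum_split x i i le_rfl hi]; simp

lemma tailSum_last {d : ℕ} (x : Fin d → ℤ) (i : ℕ) (hi : d < i + 2) : tailSum x i = 0 := by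
  unfold tailSum
  apply Finset.sum_eq_zero
  intro k
  simp only [Finset.mem_filter, Finset.mem_univ, true_and]
  omega

/-- The parametrization: `a` gives the point whose weighted tail sums are `c - 2 a i`. -/
def param {d : ℕ} (c : ℤ) (a : Fin d → ℤ) : Fin d → ℤ := fun i =>
  if h : i.val + 1 < d then a ⟨i.val + 1, h⟩ - a i else c - 2 * a i

lemma param_last {d : ℕ} (hd : 1 ≤ d) (c : ℤ) (a : Fin d → ℤ) :
    param c a ⟨d - 1, last_lt hd⟩ = c - 2 * a ⟨d - 1, last_lt hd⟩ := by
  unfold param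
  rw [dif_neg]
  simp only
  omega

lemma tailSum_param {d : ℕ} (hd : 1 ≤ d) (c : ℤ) (a : Fin d → ℤ) (m : ℕ) :
    ∀ i : Fin d, i.val + m + 1 = d →
      tailSum (param c a) i.val = a ⟨d - 1, last_lt hd⟩ - a i := by
  induction m with
  | zero =>
    intro i hi
    rw [tailSum_last _ _ (by omega)]
    have : i = ⟨d - 1, last_lt hd⟩ := by ext; simp only; omega
    rw [this]; simp
  | succ m ih =>
    intro i hi
    rw [tailSum_step _ _ (by omega)]
    have h := ih ⟨i.val + 1, by omega⟩ (by simp only; omega)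
    simp only at h
    rw [h]
    unfold param
    rw [dif_pos (by omega)]
    ring

lemma tailSum_param' {d : ℕ} (hd : 1 ≤ d) (c : ℤ) (a : Fin d → ℤ) (i : Fin d) :
    tailSum (param c a) i.val = a ⟨d - 1, last_lt hd⟩ - a i :=
  tailSum_param hd c a (d - 1 - i.val) i (by omega)

lemma param_injective {d : ℕ} (hd : 1 ≤ d) (c : ℤ) :
    Function.Injective (param c : (Fin d → ℤ) → Fin d → ℤ) := by
  intro a b h
  have h1 := param_last hd c a
  rw [h, param_last hd c b] at h1
  ext i
  have h2 := tailSum_param' hd c a i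
  rw [h, tailSum_param' hd c b i] at h2
  omega

/-- The integer box `[0, m)^d`. -/
def boxSet (d m : ℕ) : Set (Fin d → ℤ) := {a | ∀ i, 0 ≤ a i ∧ a i < m}

lemma boxSet_eq (d m : ℕ) :
    boxSet d m = (Fintype.piFinset (fun _ : Fin d => Finset.Ico (0 : ℤ) m) : Set (Fin d → ℤ)) := by
  ext a
  simp [boxSet]

lemma boxSet_finite (d m : ℕ) : (boxSet d m).Finite := by
  rw [boxSet_eq]; exact Finset.finite_toSet _

lemma boxSet_ncard (d m : ℕ) : (boxSet d m).ncard = m ^ d := by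
  rw [boxSet_eq, Set.ncard_coe_finset, Fintype.card_piFinset]
  simp

/-- Every `x` with last coordinate congruent to `c` mod 2 is parametrized. -/
lemma param_surj {d : ℕ} (hd : 1 ≤ d) (c e : ℤ) (x : Fin d → ℤ)
    (he : x ⟨d - 1, last_lt hd⟩ = c - 2 * e) :
    param c (fun i => e - tailSum x i.val) = x := by
  ext i
  unfold param
  split_ifs with h
  · have := tailSum_step x i (by omega)
    simp only
    omega
  · have hi : i = ⟨d - 1, last_lt hd⟩ := by ext; simp only; omega
    have := tailSum_last x i.val (by omega)
    simp only [this]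
    rw [hi, he]
    ring

lemma mem_iff_tail {d : ℕ} (hd : 1 ≤ d) (n : ℕ) (x : Fin d → ℤ) :
    (|x ⟨d - 1, last_lt hd⟩| ≤ (n : ℤ) ∧
        (∀ i j : Fin d, i ≤ j → j.val + 2 ≤ d → |∑ k ∈ Finset.Icc i j, x k| ≤ (n : ℤ)) ∧
        (∀ i : Fin d, i.val + 2 ≤ d →
          |2 * (∑ k ∈ Finset.univ.filter (fun k : Fin d => i ≤ k ∧ k.val + 2 ≤ d), x k) +
              x ⟨d - 1, last_lt hd⟩| ≤ (n : ℤ))) ↔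
      ∀ i : Fin d, |2 * tailSum x i.val + x ⟨d - 1, last_lt hd⟩| ≤ (n : ℤ) := by
  constructor
  · rintro ⟨h1, -, h3⟩ i
    by_cases hi : i.val + 2 ≤ d
    · exact h3 i hi
    · rw [tailSum_last x i.val (by omega)]
      simpa using h1
  · intro h
    refine ⟨?_, ?_, fun i _ => h i⟩
    · have := h ⟨d - 1, last_lt hd⟩
      rw [tailSum_last x _ (by simp only; omega)] at this
      simpa using this
    · intro i j hij hj
      have h0 := tailSum_split x i j hij hj
      have h1 := h i
      have h2 := h ⟨j.val + 1, by omega⟩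
      simp only [abs_le] at *
      omega


/-- The number of lattice points of the `n`-th dilate of the dual root polytope of
type C: `x ∈ ℤ^d` with `|x_d| ≤ n`, `|x_i + ⋯ + x_{j-1}| ≤ n` for all
`1 ≤ i < j ≤ d` (0-indexed: intervals inside the first `d-1` coordinates), and
`|2x_i + ⋯ + 2x_{d-1} + x_d| ≤ n` for `1 ≤ i ≤ d-1`, equals `(n+1)^d + n^d`. -/
theorem typeC_dual_ehrhart (d : ℕ) (hd : 1 ≤ d) (n : ℕ) :
    Set.ncard {x : Fin d → ℤ |
        |x ⟨d - 1, by omega⟩| ≤ (n : ℤ) ∧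
        (∀ i j : Fin d, i ≤ j → j.val + 2 ≤ d → |∑ k ∈ Finset.Icc i j, x k| ≤ (n : ℤ)) ∧
        (∀ i : Fin d, i.val + 2 ≤ d →
          |2 * (∑ k ∈ Finset.univ.filter (fun k : Fin d => i ≤ k ∧ k.val + 2 ≤ d), x k) +
              x ⟨d - 1, by omega⟩| ≤ (n : ℤ))} =
      (n + 1) ^ d + n ^ d := by
  have key : ∀ S : Set (Fin d → ℤ), (∀ x, x ∈ S ↔ ∀ i : Fin d,
      |2 * tailSum x i.val + x ⟨d - 1, by omega⟩| ≤ (n : ℤ)) →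
      S = param (n : ℤ) '' boxSet d (n + 1) ∪ param ((n : ℤ) - 1) '' boxSet d n := by
    intro S hS
    ext x
    rw [hS]
    constructor
    · intro h
      rcases Int.even_or_odd' ((n : ℤ) - x ⟨d - 1, by omega⟩) with ⟨e, he | he⟩
      · left
        refine ⟨_, ?_, param_surj hd n e x (by omega)⟩
        intro i
        have := abs_le.1 (h i)
        push_cast
        constructor <;> omega
      · right
        refine ⟨_, ?_, param_surj hd (n - 1) e x (by omega)⟩
        intro i
        have := abs_le.1 (h i)
        beta_reduce
        constructor <;> omega
    · rintro (⟨a, ha, rfl⟩ | ⟨a, ha, rfl⟩) i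
      · rw [tailSum_param' hd, param_last hd, abs_le]
        have := ha i
        push_cast at this
        constructor <;> omega
      · rw [tailSum_param' hd, param_last hd, abs_le]
        have := ha i
        constructor <;> omega
  refine (congrArg Set.ncard (key _ (fun x => mem_iff_tail hd n x))).trans ?_
  rw [Set.ncard_union_eq _
    ((boxSet_finite _ _).image _) ((boxSet_finite _ _).image _),
    Set.ncard_image_of_injective _ (param_injective hd _),
    Set.ncard_image_of_injective _ (param_injective hd _), boxSet_ncard, boxSet_ncard]
  rw [Set.disjoint_left]
  rintro _ ⟨a, -, rfl⟩ ⟨b, -, hb⟩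
  have h1 := param_last hd n a
  rw [← hb, param_last hd] at h1
  omega
end
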